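/- arXiv:2211.02503 — 2 statements merged into one kernel-verified Lean document; each statement's English description precedes it below -/
import Mathlib

section
/- Let C, C₁, C₂, … be strict d-dimensional Archimedean copulas, ℓ ∈ {1,…,d−2} and x ∈ (0,1)^ℓ fixed. If (C_n) converges uniformly to C, then the sequence of conditional copulas (C_nˣ) converges (d−ℓ−1)-weakly conditional to Cˣ, and moreover lim_{n→∞} |ζ₁ˣ(C_n) − ζ₁ˣ(C)| = 0, where ζ₁ˣ(C) := ζ₁^{d−ℓ}(Cˣ). -/
open MeasureTheory ProbabilityTheory Set Filter Topology
open scoped ENNReal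

noncomputable section
attribute [local instance] Classical.propDecidable

/-- The lower-orthant box `[0, y] = [0,y₁] × ⋯ × [0,y_k]` (as a lower set in `ℝ^k`;
all measures considered are supported on the unit cube). -/
def lowerBox {k : ℕ} (y : Fin k → ℝ) : Set (Fin k → ℝ) := {t | ∀ i, t i ≤ y i}

/-- The closed unit cube `[0,1]^k`. -/
def unitCube (k : ℕ) : Set (Fin k → ℝ) := {t | ∀ i, t i ∈ Icc (0 : ℝ) 1}

/-- `η` is a `k`-monotone Archimedean generator with (real-valued) pseudoinverse `ξ`. -/
structure IsRealGenerator (k : ℕ) (η ξ : ℝ → ℝ) : Prop where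
  continuousOn : ContinuousOn η (Ici 0)
  at_zero : η 0 = 1
  tendsto_zero : Tendsto η atTop (nhds 0)
  nonneg : ∀ z : ℝ, 0 ≤ z → 0 ≤ η z
  antitoneOn : AntitoneOn η (Ici 0)
  strict_anti : ∀ z₁ z₂ : ℝ, 0 ≤ z₁ → z₁ < z₂ → 0 < η z₂ → η z₂ < η z₁
  smooth : ∀ z : ℝ, 0 < z → ContDiffAt ℝ ((k - 2 : ℕ) : ℕ∞) η z
  alt_sign : ∀ m : ℕ, m ≤ k - 2 → ∀ z : ℝ, 0 < z → 0 ≤ (-1 : ℝ) ^ m * iteratedDeriv m η z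
  top_antitone : AntitoneOn (fun z => (-1 : ℝ) ^ (k - 2) * iteratedDeriv (k - 2) η z) (Ioi 0)
  top_convex : ConvexOn ℝ (Ioi 0) (fun z => (-1 : ℝ) ^ (k - 2) * iteratedDeriv (k - 2) η z)
  xi_nonneg : ∀ t : ℝ, 0 < t → t ≤ 1 → 0 ≤ ξ t
  eta_xi : ∀ t : ℝ, 0 < t → t ≤ 1 → η (ξ t) = t

/-- `ψ` is a strict `d`-monotone Archimedean generator with pseudoinverse `φ`
(strictness: `φ(0) = ∞`, equivalently `ψ > 0` on `[0,∞)` and `φ ∘ ψ = id` there). -/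
def IsStrictGenerator (d : ℕ) (ψ φ : ℝ → ℝ) : Prop :=
  IsRealGenerator d ψ φ ∧ (∀ z : ℝ, 0 ≤ z → 0 < ψ z) ∧ (∀ z : ℝ, 0 ≤ z → φ (ψ z) = z)

/-- The pseudoinverse `ξ(t) = inf{z ≥ 0 : η(z) ≤ t}` of a generator `η`. -/
def pseudoInv (η : ℝ → ℝ) (t : ℝ) : ℝ := sInf {z | 0 ≤ z ∧ η z ≤ t}

/-- The conditional Archimedean generator
`ψˣ(z) = ψ^{(ℓ)}(Σᵢ φ(xᵢ) + z) / ψ^{(ℓ)}(Σᵢ φ(xᵢ))`. -/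
def psiX (ψ φ : ℝ → ℝ) {l : ℕ} (x : Fin l → ℝ) (z : ℝ) : ℝ :=
  iteratedDeriv l ψ ((∑ i, φ (x i)) + z) / iteratedDeriv l ψ (∑ i, φ (x i))

/-- The common univariate marginal `g_x(y) = K_C(x, [0,y] × [0,1]^{d-ℓ-1})`
of the conditional distribution `K_C(x,·)` of a strict Archimedean copula; explicitly
`g_x(y) = ψ^{(ℓ)}(Σᵢ φ(xᵢ) + φ(y)) / ψ^{(ℓ)}(Σᵢ φ(xᵢ))` for `y ∈ (0,1]` and
`g_x(y) = 0` for `y ≤ 0`. -/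
def gxF (ψ φ : ℝ → ℝ) {l : ℕ} (x : Fin l → ℝ) (y : ℝ) : ℝ :=
  if y ≤ 0 then 0
  else iteratedDeriv l ψ ((∑ i, φ (x i)) + φ y) / iteratedDeriv l ψ (∑ i, φ (x i))

/-- The `ℓ`-Markov kernel of a strict `d`-dimensional Archimedean copula on the box
`[0,y]`: `K_C(x,[0,y]) = ψ^{(ℓ)}(Σᵢ φ(xᵢ) + Σⱼ φ(yⱼ)) / ψ^{(ℓ)}(Σᵢ φ(xᵢ))`
(equal to `0` whenever some `yⱼ = 0`). -/
def archKR (ψ φ : ℝ → ℝ) {l k : ℕ} (x : Fin l → ℝ) (y : Fin k → ℝ) : ℝ :=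
  if ∃ j, y j ≤ 0 then 0
  else iteratedDeriv l ψ ((∑ i, φ (x i)) + ∑ j, φ (y j)) / iteratedDeriv l ψ (∑ i, φ (x i))

/-- The conditional copula `Cˣ` of a strict Archimedean copula:
`Cˣ(u) = ψˣ(Σⱼ (ψˣ)⁻¹(uⱼ))` where `ψˣ` is the conditional generator (with the
convention `Cˣ(u) = 0` if some coordinate of `u` is `0`). -/
def condCop (ψ φ : ℝ → ℝ) {l : ℕ} (x : Fin l → ℝ) {k : ℕ} (u : Fin k → ℝ) : ℝ :=
  if ∃ j, u j ≤ 0 then 0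
  else psiX ψ φ x (∑ j, pseudoInv (psiX ψ φ x) (u j))

/-- The copula function of the Archimedean copula generated by `ψ`:
`C(x) = ψ(Σᵢ φ(xᵢ))` (with the convention `C(x) = 0` if some coordinate is `0`). -/
def archCopF (ψ φ : ℝ → ℝ) {k : ℕ} (x : Fin k → ℝ) : ℝ :=
  if ∃ i, x i ≤ 0 then 0 else ψ (∑ i, φ (x i))

/-- `K` disintegrates `μ` over its first marginal. -/
def IsDisintegration {α β : Type*} [MeasurableSpace α] [MeasurableSpace β]
    (μ : Measure (α × β)) (K : Kernel α β) : Prop :=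
  ∀ G : Set (α × β), MeasurableSet G →
    μ G = ∫⁻ a, K a (Prod.mk a ⁻¹' G) ∂(μ.map Prod.fst)

/-- Weak convergence of a sequence of (probability) measures. -/
def WeakConv {α : Type*} [MeasurableSpace α] [TopologicalSpace α]
    (μn : ℕ → Measure α) (μ : Measure α) : Prop :=
  ∀ f : BoundedContinuousFunction α ℝ,
    Tendsto (fun n => ∫ a, f a ∂(μn n)) atTop (nhds (∫ a, f a ∂μ))

/-- The dependence measure
`ζ₁(B) = 3 ∫∫ |K_B(s,[0,y]) − y| dμ_{B^{1:k-1}}(s) dλ(y)`, expressed in terms of the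
marginal measure `ν = μ_{B^{1:k-1}}` and the `(k-1)`-Markov kernel `K` of a
`k`-dimensional copula `B`. -/
def zeta1 {m : ℕ} (ν : Measure (Fin m → ℝ)) (K : Kernel (Fin m → ℝ) ℝ) : ℝ :=
  3 * ∫ y in Icc (0:ℝ) 1, (∫ s, |(K s (Iic y)).toReal - y| ∂ν)

/-- A chain of functions on an upper set `S`, each minus the derivative of the preceding one. -/
structure GChain (S : Set ℝ) (N : ℕ) (f : ℕ → ℝ → ℝ) : Prop where
  anti : ∀ k ≤ N, AntitoneOn (f k) S
  sec : ∀ k < N, ∀ a b, a ∈ S → a ≤ b →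
    (b - a) * f (k + 1) b ≤ f k a - f k b ∧ f k a - f k b ≤ (b - a) * f (k + 1) a
  pos : ∀ k ≤ N, ∀ a ∈ S, 0 < f k a
  lim : ∀ k ≤ N, Tendsto (f k) atTop (𝓝 0)

/-- constructing a chain: positivity and limits are automatic. -/
lemma GChain.mk' {N : ℕ} {f : ℕ → ℝ → ℝ}
    (anti : ∀ k ≤ N, AntitoneOn (f k) (Ioi 0))
    (sec : ∀ k < N, ∀ a b, a ∈ Ioi (0:ℝ) → a ≤ b →
      (b - a) * f (k + 1) b ≤ f k a - f k b ∧ f k a - f k b ≤ (b - a) * f (k + 1) a)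
    (pos : ∀ a ∈ Ioi (0:ℝ), 0 < f 0 a) (lim : Tendsto (f 0) atTop (𝓝 0))
    (nonneg : ∀ k ≤ N, ∀ a ∈ Ioi (0:ℝ), 0 ≤ f k a) :
    GChain (Ioi 0) N f := by
  have hlim : ∀ k ≤ N, Tendsto (f k) atTop (𝓝 0) := by
    intro k
    induction k with
    | zero => intro _; exact lim
    | succ k ih =>
      intro hk
      have h1 := ih (by omega)
      have h2 : Tendsto (fun a => f k (a - 1) - f k a) atTop (𝓝 0) := by
        have := (h1.comp (tendsto_atTop_add_const_right atTop (-1:ℝ) tendsto_id)).sub h1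
        simpa [Function.comp_def, sub_eq_add_neg] using this
      refine tendsto_of_tendsto_of_tendsto_of_le_of_le' tendsto_const_nhds h2 ?_ ?_
      · filter_upwards [eventually_gt_atTop 0] with a ha using nonneg _ hk a ha
      · filter_upwards [eventually_gt_atTop 1] with a ha
        have := (sec k (by omega) (a - 1) a (by simpa using ha) (by linarith)).1
        simpa using this
  refine ⟨anti, sec, ?_, hlim⟩
  intro k
  induction k with
  | zero => intro _; exact pos
  | succ k ih =>
    intro hk a ha
    have ha' : 0 < a := ha
    rcases (nonneg _ hk a ha).lt_or_eq with h | h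
    · exact h
    exfalso
    have h0 := ih (by omega) a ha
    have h1 : ∀ᶠ b in atTop, f k a ≤ f k b := by
      filter_upwards [eventually_ge_atTop a] with b hb
      have := (sec k (by omega) a b ha hb).2
      rw [← h] at this
      linarith
    have := ge_of_tendsto (hlim k (by omega)) h1
    linarith

/-- the chain of a generator -/
def fchain (ψ : ℝ → ℝ) (N k : ℕ) (z : ℝ) : ℝ :=
  if k ≤ N then (-1 : ℝ) ^ k * iteratedDeriv k ψ z
  else -(derivWithin (fun z => (-1 : ℝ) ^ N * iteratedDeriv N ψ z) (Ioi z) z)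

lemma fchain_le (ψ : ℝ → ℝ) {N k : ℕ} (h : k ≤ N) (z : ℝ) :
    fchain ψ N k z = (-1 : ℝ) ^ k * iteratedDeriv k ψ z := by
  simp [fchain, h]

lemma fchain_top (ψ : ℝ → ℝ) {N : ℕ} (z : ℝ) :
    fchain ψ N (N + 1) z
      = -(derivWithin (fun z => (-1 : ℝ) ^ N * iteratedDeriv N ψ z) (Ioi z) z) := by
  simp [fchain]

lemma gchain_of_generator {N : ℕ} {ψ φ : ℝ → ℝ} (h : IsStrictGenerator (N + 2) ψ φ) :
    GChain (Ioi 0) (N + 1) (fchain ψ N) := by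
  obtain ⟨hr, hpos, hinv⟩ := h
  have hN : N + 2 - 2 = N := by omega
  have hsm := hr.smooth
  have hal := hr.alt_sign
  have hta := hr.top_antitone
  have htc := hr.top_convex
  rw [hN] at hsm hal hta htc
  have hder : ∀ k < N, ∀ z : ℝ, 0 < z →
      HasDerivAt (fchain ψ N k) (-(fchain ψ N (k + 1) z)) z := by
    intro k hk z hz
    have e : fchain ψ N k = fun z => (-1 : ℝ) ^ k * iteratedDeriv k ψ z := by
      funext z; exact fchain_le ψ hk.le z
    rw [e, fchain_le ψ (by omega)]
    have hd : DifferentiableAt ℝ (iteratedDeriv k ψ) z := by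
      have h1 : ContDiffAt ℝ (N : WithTop ℕ∞) ψ z := by simpa using hsm z hz
      have h2 := ContDiffWithinAt.differentiableWithinAt_iteratedDerivWithin (m := k)
        (contDiffWithinAt_univ.2 h1) (by exact_mod_cast hk) (by simpa using uniqueDiffOn_univ)
      rw [iteratedDerivWithin_univ] at h2
      exact differentiableWithinAt_univ.1 h2
    have := hd.hasDerivAt.const_mul ((-1:ℝ)^k)
    have e2 : -((-1:ℝ) ^ (k + 1) * iteratedDeriv (k + 1) ψ z)
        = (-1) ^ k * deriv (iteratedDeriv k ψ) z := by
      rw [iteratedDeriv_succ, pow_succ]; ring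
    rw [e2]
    exact this
  have hnn : ∀ k ≤ N, ∀ a ∈ Ioi (0:ℝ), 0 ≤ fchain ψ N k a := by
    intro k hk a ha
    rw [fchain_le ψ hk]
    exact hal k hk a ha
  have hanti : ∀ k ≤ N, AntitoneOn (fchain ψ N k) (Ioi 0) := by
    intro k hk
    rcases hk.lt_or_eq with hlt | rfl
    · refine antitoneOn_of_deriv_nonpos (convex_Ioi 0)
        (fun z hz => (hder k hlt z hz).continuousAt.continuousWithinAt)
        (fun z hz => ?_) (fun z hz => ?_)
      · rw [interior_Ioi] at hz
        exact (hder k hlt z hz).differentiableAt.differentiableWithinAt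
      · rw [interior_Ioi] at hz
        rw [(hder k hlt z hz).deriv]
        have := hnn (k + 1) hlt z hz
        linarith
    · have e : fchain ψ k k = fun z => (-1 : ℝ) ^ k * iteratedDeriv k ψ z := by
        funext z; exact fchain_le ψ le_rfl z
      rw [e]; exact hta
  have hNe : fchain ψ N N = fun z => (-1 : ℝ) ^ N * iteratedDeriv N ψ z := by
    funext z; exact fchain_le ψ le_rfl z
  have hcv : ConvexOn ℝ (Ioi 0) (fchain ψ N N) := by rw [hNe]; exact htc
  have htop : fchain ψ N (N + 1) = fun z => -(derivWithin (fchain ψ N N) (Ioi z) z) := by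
    funext z; rw [fchain_top, hNe]
  have hsec : ∀ k < N + 1, ∀ a b, a ∈ Ioi (0:ℝ) → a ≤ b →
      (b - a) * fchain ψ N (k + 1) b ≤ fchain ψ N k a - fchain ψ N k b ∧
        fchain ψ N k a - fchain ψ N k b ≤ (b - a) * fchain ψ N (k + 1) a := by
    intro k hk a b ha hab
    rcases hab.eq_or_lt with rfl | hlt
    · simp
    have ha0 : 0 < a := ha
    have hb0 : 0 < b := ha0.trans hlt
    rcases (Nat.lt_succ_iff.1 hk).lt_or_eq with hkN | rfl
    · obtain ⟨c, hc, hce⟩ := exists_hasDerivAt_eq_slope (fchain ψ N k)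
        (fun z => -(fchain ψ N (k + 1) z)) hlt
        (fun z hz => (hder k hkN z (ha0.trans_le hz.1)).continuousAt.continuousWithinAt)
        (fun z hz => hder k hkN z (ha0.trans hz.1))
      have hba : 0 < b - a := by linarith
      have e : fchain ψ N k a - fchain ψ N k b = (b - a) * fchain ψ N (k + 1) c := by
        field_simp at hce
        linarith
      have hc0 : 0 < c := ha0.trans hc.1
      rw [e]
      exact ⟨mul_le_mul_of_nonneg_left (hanti (k + 1) hkN hc0 hb0 hc.2.le) hba.le,
        mul_le_mul_of_nonneg_left (hanti (k + 1) hkN ha hc0 hc.1.le) hba.le⟩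
    · have hba : 0 < b - a := by linarith
      have hai : a ∈ interior (Ioi (0:ℝ)) := by rwa [interior_Ioi]
      have hbi : b ∈ interior (Ioi (0:ℝ)) := by rwa [interior_Ioi]
      have h1 := hcv.rightDeriv_le_slope_of_mem_interior hai (y := b) hb0 hlt
      have h2 := (hcv.slope_le_leftDeriv_of_mem_interior (x := a) ha hbi hlt).trans
        (hcv.leftDeriv_le_rightDeriv_of_mem_interior hbi)
      rw [slope_def_field] at h1 h2
      rw [le_div_iff₀ hba] at h1
      rw [div_le_iff₀ hba] at h2
      rw [htop]
      constructor <;> simp only <;> nlinarith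
  have hanti' : ∀ k ≤ N + 1, AntitoneOn (fchain ψ N k) (Ioi 0) := by
    intro k hk
    rcases Nat.le_succ_iff.1 hk with h | rfl
    · exact hanti k h
    · rw [htop]
      have := hcv.monotoneOn_rightDeriv
      rw [interior_Ioi] at this
      exact this.neg
  refine GChain.mk' hanti' hsec ?_ ?_ ?_
  · intro a ha
    rw [fchain_le ψ (Nat.zero_le _)]
    simpa using hpos a (le_of_lt ha)
  · have : fchain ψ N 0 = ψ := by
      funext z
      rw [fchain_le ψ (Nat.zero_le _)]; simp
    rw [this]; exact hr.tendsto_zero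
  · intro k hk a ha
    rcases Nat.le_succ_iff.1 hk with h | rfl
    · exact hnn k h a ha
    · have ha0 : (0:ℝ) < a := ha
      have h1 := (hsec N (by omega) a (a + 1) ha (by linarith)).2
      have h2 := hanti N le_rfl ha (show a + 1 ∈ Ioi (0:ℝ) by simp; linarith) (by linarith)
      simp at h1
      linarith

lemma GChain.scale {N : ℕ} {f : ℕ → ℝ → ℝ} (h : GChain (Ioi 0) N f) {c : ℝ} (hc : 0 < c) :
    GChain (Ioi 0) N (fun k z => c ^ k * f k (c * z)) := by
  have hm : ∀ a : ℝ, a ∈ Ioi (0:ℝ) → c * a ∈ Ioi (0:ℝ) := fun a ha => mul_pos hc ha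
  refine ⟨?_, ?_, ?_, ?_⟩
  · intro k hk a ha b hb hab
    exact mul_le_mul_of_nonneg_left
      (h.anti k hk (hm a ha) (hm b hb) (mul_le_mul_of_nonneg_left hab hc.le)) (by positivity)
  · intro k hk a b ha hab
    have := h.sec k hk (c * a) (c * b) (hm a ha) (mul_le_mul_of_nonneg_left hab hc.le)
    have hp : 0 ≤ c ^ k := by positivity
    constructor
    · have := mul_le_mul_of_nonneg_left this.1 hp
      simp only [pow_succ]; nlinarith
    · have := mul_le_mul_of_nonneg_left this.2 hp
      simp only [pow_succ]; nlinarith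
  · intro k hk a ha
    have := h.pos k hk _ (hm a ha)
    positivity
  · intro k hk
    have h1 : Tendsto (fun z => c * z) atTop atTop := tendsto_id.const_mul_atTop hc
    simpa using ((h.lim k hk).comp h1).const_mul (c ^ k)

/-- shifted and normalised chain, extended constantly to the left of zero -/
def shiftChain (f : ℕ → ℝ → ℝ) (l : ℕ) (σ : ℝ) (k : ℕ) (z : ℝ) : ℝ :=
  f (l + k) (σ + max z 0) / f l σ

lemma GChain.shift {N l : ℕ} {f : ℕ → ℝ → ℝ} (h : GChain (Ioi 0) (l + N) f) {σ : ℝ}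
    (hσ : 0 < σ) : GChain (Ici 0) N (shiftChain f l σ) := by
  have h0 : 0 < f l σ := h.pos l (by omega) σ hσ
  refine ⟨?_, ?_, ?_, ?_⟩
  · intro k hk a ha b hb hab
    have ha' : (0:ℝ) ≤ a := ha
    have hb' : (0:ℝ) ≤ b := hb
    unfold shiftChain
    rw [max_eq_left ha', max_eq_left hb']
    gcongr
    exact h.anti _ (by omega) (show (0:ℝ) < _ by linarith) (show (0:ℝ) < _ by linarith)
      (by linarith)
  · intro k hk a b ha hab
    have ha' : (0:ℝ) ≤ a := ha
    unfold shiftChain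
    rw [max_eq_left ha', max_eq_left (ha'.trans hab)]
    have := h.sec (l + k) (by omega) (σ + a) (σ + b) (show (0:ℝ) < _ by linarith) (by linarith)
    rw [← sub_div, ← mul_div_assoc, ← mul_div_assoc, div_le_div_iff_of_pos_right h0,
      div_le_div_iff_of_pos_right h0]
    have e : σ + b - (σ + a) = b - a := by ring
    rw [e] at this
    exact this
  · intro k hk a ha
    unfold shiftChain
    refine div_pos (h.pos _ (by omega) _ ?_) h0
    have := le_max_right a 0
    exact (show (0:ℝ) < _ by linarith)
  · intro k hk
    have h1 : Tendsto (fun z : ℝ => σ + max z 0) atTop atTop :=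
      tendsto_atTop_add_const_left _ _ (tendsto_atTop_mono (fun z => le_max_left z 0) tendsto_id)
    have h2 := ((h.lim (l + k) (by omega)).comp h1).div_const (f l σ)
    rw [zero_div] at h2
    exact h2

lemma GChain.shift_antitone {N l : ℕ} {f : ℕ → ℝ → ℝ} (h : GChain (Ioi 0) (l + N) f) {σ : ℝ}
    (hσ : 0 < σ) (k : ℕ) (hk : k ≤ N) : Antitone (shiftChain f l σ k) := by
  intro a b hab
  have h0 : 0 < f l σ := h.pos l (by omega) σ hσ
  unfold shiftChain
  have h1 := le_max_right a 0
  have h2 := le_max_right b 0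
  gcongr
  exact h.anti _ (by omega) (show (0:ℝ) < _ by linarith) (show (0:ℝ) < _ by linarith)
      (by gcongr)

lemma GChain.shift_zero {N l : ℕ} {f : ℕ → ℝ → ℝ} (h : GChain (Ioi 0) (l + N) f) {σ : ℝ}
    (hσ : 0 < σ) : shiftChain f l σ 0 0 = 1 := by
  have h0 : 0 < f l σ := h.pos l (by omega) σ hσ
  simp [shiftChain, h0.ne']

lemma GChain.mono {N : ℕ} {f : ℕ → ℝ → ℝ} (h : GChain (Ici 0) N f) : GChain (Ioi 0) N f :=
  ⟨fun k hk => (h.anti k hk).mono Ioi_subset_Ici_self,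
    fun k hk a b ha hab => h.sec k hk a b (Ioi_subset_Ici_self ha) hab,
    fun k hk a ha => h.pos k hk a (Ioi_subset_Ici_self ha), h.lim⟩

lemma GChain.lip {N : ℕ} {f : ℕ → ℝ → ℝ} (h : GChain (Ioi 0) N f) {k : ℕ} (hk : k < N)
    {w : ℝ} (hw : 0 < w) : ContinuousAt (f k) w := by
  have hw2 : 0 < w / 2 := by linarith
  set L := f (k + 1) (w / 2)
  have hL : 0 < L := h.pos _ hk _ hw2
  have key : ∀ᶠ z in 𝓝 w, |f k z - f k w| ≤ L * |z - w| := by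
    filter_upwards [lt_mem_nhds (show w / 2 < w by linarith)] with z hz
    have hz0 : 0 < z := hw2.trans hz
    rcases le_total z w with hzw | hzw
    · have h1 := (h.sec k hk z w hz0 hzw).2
      have h2 := h.anti k hk.le hz0 hw hzw
      have h3 := h.anti (k+1) hk hw2 hz0 hz.le
      rw [abs_of_nonneg (by linarith), abs_of_nonpos (by linarith)]
      have : (w - z) * f (k+1) z ≤ (w - z) * L := mul_le_mul_of_nonneg_left h3 (by linarith)
      nlinarith
    · have h1 := (h.sec k hk w z hw hzw).2
      have h2 := h.anti k hk.le hw hz0 hzw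
      have h3 := h.anti (k+1) hk hw2 hw (by linarith)
      rw [abs_of_nonpos (by linarith), abs_of_nonneg (by linarith)]
      have : (z - w) * f (k+1) w ≤ (z - w) * L := mul_le_mul_of_nonneg_left h3 (by linarith)
      nlinarith
  rw [ContinuousAt, tendsto_iff_dist_tendsto_zero]
  have h0 : Tendsto (fun z => L * |z - w|) (𝓝 w) (𝓝 0) := by
    have : Continuous fun z : ℝ => L * |z - w| := by fun_prop
    simpa using this.tendsto w
  refine squeeze_zero' (Eventually.of_forall fun z => dist_nonneg) ?_ h0
  filter_upwards [key] with z hz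
  simpa [Real.dist_eq] using hz

/-- one sandwich step -/
lemma sandwich {fn : ℕ → ℝ → ℝ} {f : ℝ → ℝ} {wn : ℕ → ℝ} {w : ℝ}
    (hc : ContinuousAt f w)
    (hup : ∀ a, 0 < a → a < w → ∀ e > f a, ∀ᶠ n in atTop, fn n (wn n) < e)
    (hlo : ∀ b, w < b → ∀ e < f b, ∀ᶠ n in atTop, e < fn n (wn n)) (hw : 0 < w) :
    Tendsto (fun n => fn n (wn n)) atTop (𝓝 (f w)) := by
  rw [tendsto_order]
  constructor
  · intro e he
    have h1 : ∀ᶠ z in 𝓝[>] w, e < f z := (hc.tendsto.mono_left nhdsWithin_le_nhds).eventually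
      (lt_mem_nhds he)
    obtain ⟨b, hb1, hb2⟩ := (h1.and self_mem_nhdsWithin).exists
    exact hlo b hb2 e hb1
  · intro e he
    have h1 : ∀ᶠ z in 𝓝[<] w, f z < e := (hc.tendsto.mono_left nhdsWithin_le_nhds).eventually
      (gt_mem_nhds he)
    have h2 : ∀ᶠ z in 𝓝[<] w, 0 < z := mem_nhdsWithin_of_mem_nhds (lt_mem_nhds hw)
    obtain ⟨b, ⟨hb1, hb3⟩, hb2⟩ := ((h1.and h2).and self_mem_nhdsWithin).exists
    exact hup b hb3 hb2 e hb1

lemma chain_conv {N : ℕ} {fn : ℕ → ℕ → ℝ → ℝ} {f : ℕ → ℝ → ℝ}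
    (hn : ∀ n, GChain (Ioi 0) N (fn n)) (h : GChain (Ioi 0) N f)
    (h0 : ∀ z, 0 < z → Tendsto (fun n => fn n 0 z) atTop (𝓝 (f 0 z))) :
    ∀ k ≤ N, ∀ (wn : ℕ → ℝ) (w : ℝ), 0 < w → Tendsto wn atTop (𝓝 w) → ContinuousAt (f k) w →
      Tendsto (fun n => fn n k (wn n)) atTop (𝓝 (f k w)) := by
  intro k
  induction k with
  | zero =>
    intro _ wn w hw hwn hc
    refine sandwich (fn := fun n => fn n 0) hc ?_ ?_ hw
    · intro a ha haw e he
      filter_upwards [(h0 a ha).eventually (gt_mem_nhds he), hwn.eventually (lt_mem_nhds haw)]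
        with n h1 h2
      exact ((hn n).anti 0 (Nat.zero_le _) ha (show (0:ℝ) < _ by linarith) h2.le).trans_lt h1
    · intro b hb e he
      filter_upwards [(h0 b (hw.trans hb)).eventually (lt_mem_nhds he),
        hwn.eventually (gt_mem_nhds hb), hwn.eventually (lt_mem_nhds hw)] with n h1 h2 h3
      exact h1.trans_le ((hn n).anti 0 (Nat.zero_le _) h3 (show (0:ℝ) < _ by linarith) h2.le)
  | succ k ih =>
    intro hk wn w hw hwn hc
    have ih' : ∀ z, 0 < z → Tendsto (fun n => fn n k z) atTop (𝓝 (f k z)) := fun z hz =>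
      ih (by omega) (fun _ => z) z hz tendsto_const_nhds (h.lip (by omega) hz)
    refine sandwich (fn := fun n => fn n (k+1)) hc ?_ ?_ hw
    · intro a ha haw e he
      obtain ⟨b, hab, hbw⟩ := exists_between haw
      have hba : 0 < b - a := by linarith
      have h1 : Tendsto (fun n => (fn n k a - fn n k b) / (b - a)) atTop
        (𝓝 ((f k a - f k b) / (b - a))) :=
        ((ih' a ha).sub (ih' b (ha.trans hab))).div_const _
      have h2 : (f k a - f k b) / (b - a) < e := by
        refine lt_of_le_of_lt ?_ he
        rw [div_le_iff₀ hba]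
        have := (h.sec k (by omega) a b ha hab.le).2
        linarith
      filter_upwards [h1.eventually (gt_mem_nhds h2), hwn.eventually (lt_mem_nhds hbw)] with n h3 h4
      have h5 := ((hn n).sec k (by omega) a b ha hab.le).1
      have h6 := (hn n).anti (k+1) hk (show (0:ℝ) < b by linarith) (show (0:ℝ) < _ by linarith) h4.le
      have h7 : fn n (k+1) b ≤ (fn n k a - fn n k b) / (b - a) := by
        rw [le_div_iff₀ hba]; linarith
      linarith
    · intro b hb e he
      obtain ⟨a, haw, hab⟩ := exists_between hb
      have ha : 0 < a := hw.trans haw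
      have hba : 0 < b - a := by linarith
      have h1 : Tendsto (fun n => (fn n k a - fn n k b) / (b - a)) atTop
        (𝓝 ((f k a - f k b) / (b - a))) :=
        ((ih' a ha).sub (ih' b (ha.trans hab))).div_const _
      have h2 : e < (f k a - f k b) / (b - a) := by
        refine lt_of_lt_of_le he ?_
        rw [le_div_iff₀ hba]
        have := (h.sec k (by omega) a b ha hab.le).1
        linarith
      filter_upwards [h1.eventually (lt_mem_nhds h2), hwn.eventually (gt_mem_nhds haw),
        hwn.eventually (lt_mem_nhds hw)] with n h3 h4 h8
      have h5 := ((hn n).sec k (by omega) a b ha hab.le).2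
      have h6 := (hn n).anti (k+1) hk h8 (show (0:ℝ) < a by linarith) h4.le
      have h7 : (fn n k a - fn n k b) / (b - a) ≤ fn n (k+1) a := by
        rw [div_le_iff₀ hba]; linarith
      linarith

/-- convergence of inverses -/
lemma inv_conv {Fn : ℕ → ℝ → ℝ} {F : ℝ → ℝ} {yn : ℕ → ℝ} {y : ℝ}
    (hFn : ∀ n, AntitoneOn (Fn n) (Ici 0)) (hF : StrictAntiOn F (Ici 0))
    (hc : ∀ z, 0 < z → Tendsto (fun n => Fn n z) atTop (𝓝 (F z)))
    (hyn : ∀ n, 0 ≤ yn n) (hy : 0 ≤ y)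
    (hvn : Tendsto (fun n => Fn n (yn n)) atTop (𝓝 (F y))) :
    Tendsto yn atTop (𝓝 y) := by
  rw [tendsto_order]
  constructor
  · intro a ha
    rcases lt_or_ge a 0 with h0 | h0
    · exact Eventually.of_forall fun n => h0.trans_le (hyn n)
    obtain ⟨a', h1, h2⟩ := exists_between ha
    have ha' : 0 < a' := by linarith
    have hlt : F y < F a' := hF (show (0:ℝ) ≤ a' by linarith) hy h2
    obtain ⟨e, he1, he2⟩ := exists_between hlt
    filter_upwards [hvn.eventually (gt_mem_nhds he1), (hc a' ha').eventually (lt_mem_nhds he2)]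
      with n h3 h4
    by_contra hcon
    push Not at hcon
    have := hFn n (hyn n) (show (0:ℝ) ≤ a' by linarith) (hcon.trans h1.le)
    linarith
  · intro b hb
    have hb0 : 0 < b := hy.trans_lt hb
    have hlt : F b < F y := hF hy hb0.le hb
    obtain ⟨e, he1, he2⟩ := exists_between hlt
    filter_upwards [hvn.eventually (lt_mem_nhds he2), (hc b hb0).eventually (gt_mem_nhds he1)]
      with n h3 h4
    by_contra hcon
    push Not at hcon
    have := hFn n hb0.le (hyn n) hcon
    linarith
section gens
variable {d : ℕ} {ψ φ : ℝ → ℝ}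

lemma IsStrictGenerator.strictAnti (h : IsStrictGenerator d ψ φ) : StrictAntiOn ψ (Ici 0) := by
  intro a ha b hb hab
  exact h.1.strict_anti a b ha hab (h.2.1 b hb)

lemma IsStrictGenerator.le_one (h : IsStrictGenerator d ψ φ) {z : ℝ} (hz : 0 ≤ z) : ψ z ≤ 1 := by
  rw [← h.1.at_zero]
  exact h.1.antitoneOn (show (0:ℝ) ≤ 0 from le_rfl) hz hz

lemma IsStrictGenerator.mem (h : IsStrictGenerator d ψ φ) {z : ℝ} (hz : 0 ≤ z) :
    ψ z ∈ Ioc (0:ℝ) 1 := ⟨h.2.1 z hz, h.le_one hz⟩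

lemma IsStrictGenerator.phi_one (h : IsStrictGenerator d ψ φ) : φ 1 = 0 := by
  have := h.2.2 0 le_rfl
  rwa [h.1.at_zero] at this

lemma IsStrictGenerator.phi_pos (h : IsStrictGenerator d ψ φ) {u : ℝ} (hu : u ∈ Ioo (0:ℝ) 1) :
    0 < φ u := by
  rcases (h.1.xi_nonneg u hu.1 hu.2.le).lt_or_eq with h1 | h1
  · exact h1
  · have := h.1.eta_xi u hu.1 hu.2.le
    rw [← h1, h.1.at_zero] at this
    exact absurd hu.2 (by linarith)

lemma arch_two (h : IsStrictGenerator d ψ φ) {N : ℕ} {u v : ℝ} (hu : u ∈ Ioc (0:ℝ) 1)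
    (hv : v ∈ Ioc (0:ℝ) 1) :
    archCopF ψ φ (Fin.cons v (Fin.cons u (fun _ => 1)) : Fin (N + 2) → ℝ) = ψ (φ v + φ u) := by
  unfold archCopF
  rw [if_neg]
  · rw [Fin.sum_univ_succ, Fin.sum_univ_succ]
    simp [h.phi_one]
  · push Not
    intro i
    refine Fin.cases ?_ (fun j => ?_) i
    · simpa using hv.1
    · refine Fin.cases ?_ (fun k => ?_) j
      · simpa using hu.1
      · simp

lemma cube_two {N : ℕ} {u v : ℝ} (hu : u ∈ Ioc (0:ℝ) 1)
    (hv : v ∈ Ioc (0:ℝ) 1) :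
    (Fin.cons v (Fin.cons u (fun _ => 1)) : Fin (N + 2) → ℝ) ∈ unitCube (N + 2) := by
  intro i
  refine Fin.cases ?_ (fun j => ?_) i
  · simpa using ⟨hv.1.le, hv.2⟩
  · refine Fin.cases ?_ (fun k => ?_) j
    · simpa using ⟨hu.1.le, hu.2⟩
    · simp

end gens

section conv
variable {N : ℕ} {ψ φ : ℝ → ℝ} {ψn φn : ℕ → ℝ → ℝ}

lemma two_conv
    (hgen : IsStrictGenerator (N + 2) ψ φ)
    (hgenn : ∀ n, IsStrictGenerator (N + 2) (ψn n) (φn n))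
    (hconv : TendstoUniformlyOn (fun n => archCopF (ψn n) (φn n))
      (archCopF ψ φ (k := N + 2)) atTop (unitCube (N + 2)))
    {vn : ℕ → ℝ} {v u : ℝ} (hvn : ∀ n, vn n ∈ Ioc (0:ℝ) 1) (hv : v ∈ Ioc (0:ℝ) 1)
    (hu : u ∈ Ioc (0:ℝ) 1) (hlim : Tendsto vn atTop (𝓝 v)) :
    Tendsto (fun n => ψn n (φn n (vn n) + φn n u)) atTop (𝓝 (ψ (φ v + φ u))) := by
  have hφ : Tendsto (fun n => φ (vn n)) atTop (𝓝 (φ v)) := by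
    refine inv_conv (Fn := fun _ => ψ) (F := ψ) (fun _ => hgen.1.antitoneOn) hgen.strictAnti
      (fun z _ => tendsto_const_nhds) (fun n => hgen.1.xi_nonneg _ (hvn n).1 (hvn n).2)
      (hgen.1.xi_nonneg _ hv.1 hv.2) ?_
    simp only [hgen.1.eta_xi _ (hvn _).1 (hvn _).2, hgen.1.eta_xi _ hv.1 hv.2]
    exact hlim
  have hu0 := hgen.1.xi_nonneg _ hu.1 hu.2
  have h1 : Tendsto (fun n => ψ (φ (vn n) + φ u)) atTop (𝓝 (ψ (φ v + φ u))) := by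
    have hmem : φ v + φ u ∈ Ici (0:ℝ) := add_nonneg (hgen.1.xi_nonneg _ hv.1 hv.2) hu0
    refine (hgen.1.continuousOn _ hmem).tendsto.comp (tendsto_nhdsWithin_iff.2
      ⟨hφ.add_const _, Eventually.of_forall fun n =>
        add_nonneg (hgen.1.xi_nonneg _ (hvn n).1 (hvn n).2) hu0⟩)
  rw [Metric.tendsto_atTop] at h1 ⊢
  intro ε hε
  obtain ⟨M1, hM1⟩ := h1 (ε / 2) (by linarith)
  obtain ⟨M2, hM2⟩ := eventually_atTop.1 (Metric.tendstoUniformlyOn_iff.1 hconv (ε / 2) (by linarith))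
  refine ⟨max M1 M2, fun n hn => ?_⟩
  have h3 := hM1 n (le_trans (le_max_left _ _) hn)
  have h4 := hM2 n (le_trans (le_max_right _ _) hn) _ (cube_two hu (hvn n))
  rw [arch_two hgen hu (hvn n), arch_two (hgenn n) hu (hvn n), dist_comm] at h4
  calc _ ≤ _ := dist_triangle _ _ _
    _ < ε := by linarith

lemma mul_conv
    (hgen : IsStrictGenerator (N + 2) ψ φ)
    (hgenn : ∀ n, IsStrictGenerator (N + 2) (ψn n) (φn n))
    (hconv : TendstoUniformlyOn (fun n => archCopF (ψn n) (φn n))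
      (archCopF ψ φ (k := N + 2)) atTop (unitCube (N + 2)))
    {u : ℝ} (hu : u ∈ Ioc (0:ℝ) 1) (p : ℕ) :
    Tendsto (fun n => ψn n (p * φn n u)) atTop (𝓝 (ψ (p * φ u))) := by
  have hu0 := hgen.1.xi_nonneg _ hu.1 hu.2
  have hun := fun n => (hgenn n).1.xi_nonneg _ hu.1 hu.2
  induction p with
  | zero => simp [hgen.1.at_zero, (hgenn _).1.at_zero]
  | succ p ih =>
    have h1 : ∀ n, 0 ≤ p * φn n u := fun n => mul_nonneg (Nat.cast_nonneg _) (hun n)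
    have h2 : 0 ≤ p * φ u := mul_nonneg (Nat.cast_nonneg _) hu0
    have := two_conv hgen hgenn hconv (fun n => (hgenn n).mem (h1 n)) (hgen.mem h2) hu ih
    rw [hgen.2.2 _ h2] at this
    simp only [(hgenn _).2.2 _ (h1 _)] at this
    simpa [add_mul] using this

lemma ratio_conv
    (hgen : IsStrictGenerator (N + 2) ψ φ)
    (hgenn : ∀ n, IsStrictGenerator (N + 2) (ψn n) (φn n))
    (hconv : TendstoUniformlyOn (fun n => archCopF (ψn n) (φn n))
      (archCopF ψ φ (k := N + 2)) atTop (unitCube (N + 2)))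
    {u v : ℝ} (hu : u ∈ Ioo (0:ℝ) 1) (hv : v ∈ Ioo (0:ℝ) 1) :
    Tendsto (fun n => φn n u / φn n v) atTop (𝓝 (φ u / φ v)) := by
  have hu' : u ∈ Ioc (0:ℝ) 1 := ⟨hu.1, hu.2.le⟩
  have hv' : v ∈ Ioc (0:ℝ) 1 := ⟨hv.1, hv.2.le⟩
  have hup := hgen.phi_pos hu
  have hvp := hgen.phi_pos hv
  have hupn := fun n => (hgenn n).phi_pos hu
  have hvpn := fun n => (hgenn n).phi_pos hv
  have key : ∀ {u v : ℝ}, u ∈ Ioo (0:ℝ) 1 → v ∈ Ioo (0:ℝ) 1 → ∀ p q : ℕ,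
      p * φ u < q * φ v → ∀ᶠ n in atTop, p * φn n u < q * φn n v := by
    intro u v hu hv p q hpq
    have hup := hgen.phi_pos hu
    have hvp := hgen.phi_pos hv
    have hupn := fun n => (hgenn n).phi_pos hu
    have hvpn := fun n => (hgenn n).phi_pos hv
    have h1 := mul_conv hgen hgenn hconv (u := u) ⟨hu.1, hu.2.le⟩ p
    have h2 := mul_conv hgen hgenn hconv (u := v) ⟨hv.1, hv.2.le⟩ q
    have hlt : ψ (q * φ v) < ψ (p * φ u) := hgen.strictAnti
      (show (0:ℝ) ≤ _ by positivity) (show (0:ℝ) ≤ _ by positivity) hpq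
    obtain ⟨e, he1, he2⟩ := exists_between hlt
    filter_upwards [h1.eventually (lt_mem_nhds he2), h2.eventually (gt_mem_nhds he1)] with n h3 h4
    by_contra hcon
    push Not at hcon
    have a1 := hupn n
    have a2 := hvpn n
    have := (hgenn n).1.antitoneOn (show (0:ℝ) ≤ q * φn n v by positivity)
      (show (0:ℝ) ≤ p * φn n u by positivity) hcon
    linarith
  rw [tendsto_order]
  constructor
  · intro a ha
    rcases lt_or_ge a 0 with h0 | h0
    · exact Eventually.of_forall fun n => h0.trans (div_pos (hupn n) (hvpn n))
    obtain ⟨r, hr1, hr2⟩ := exists_rat_btwn ha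
    have hr0 : (0:ℝ) < r := h0.trans_lt hr1
    have hr0' : 0 < r := by exact_mod_cast hr0
    have hrr : (r : ℝ) = (r.num.toNat : ℝ) / (r.den : ℝ) := by
      have h5 : (r.num.toNat : ℤ) = r.num := Int.toNat_of_nonneg (Rat.num_pos.2 hr0').le
      have h6 : ((r.num.toNat : ℤ) : ℝ) = r.num := by rw [h5]
      rw [Rat.cast_def, ← h6, Int.cast_natCast]
    have hd : (0:ℝ) < r.den := by exact_mod_cast r.den_pos
    rw [hrr, div_lt_div_iff₀ hd hvp] at hr2
    filter_upwards [key hv hu r.num.toNat r.den (by linarith)] with n hn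
    refine hr1.trans ?_
    rw [hrr, div_lt_div_iff₀ hd (hvpn n)]
    linarith
  · intro a ha
    obtain ⟨r, hr1, hr2⟩ := exists_rat_btwn ha
    have hr0 : (0:ℝ) < r := (div_pos hup hvp).trans hr1
    have hr0' : 0 < r := by exact_mod_cast hr0
    have hrr : (r : ℝ) = (r.num.toNat : ℝ) / (r.den : ℝ) := by
      have h5 : (r.num.toNat : ℤ) = r.num := Int.toNat_of_nonneg (Rat.num_pos.2 hr0').le
      have h6 : ((r.num.toNat : ℤ) : ℝ) = r.num := by rw [h5]
      rw [Rat.cast_def, ← h6, Int.cast_natCast]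
    have hd : (0:ℝ) < r.den := by exact_mod_cast r.den_pos
    rw [hrr, div_lt_div_iff₀ hvp hd] at hr1
    filter_upwards [key hu hv r.den r.num.toNat (by linarith)] with n hn
    refine lt_trans ?_ hr2
    rw [hrr, div_lt_div_iff₀ (hvpn n) hd]
    linarith

lemma exists_norm
    (hgen : IsStrictGenerator (N + 2) ψ φ)
    (hgenn : ∀ n, IsStrictGenerator (N + 2) (ψn n) (φn n))
    (hconv : TendstoUniformlyOn (fun n => archCopF (ψn n) (φn n))
      (archCopF ψ φ (k := N + 2)) atTop (unitCube (N + 2))) : ∃ c : ℕ → ℝ, (∀ n, 0 < c n) ∧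
    (∀ u ∈ Ioo (0:ℝ) 1, Tendsto (fun n => φn n u / c n) atTop (𝓝 (φ u))) ∧
    ∀ z, 0 < z → Tendsto (fun n => ψn n (c n * z)) atTop (𝓝 (ψ z)) := by
  have hh : (1/2 : ℝ) ∈ Ioo (0:ℝ) 1 := by constructor <;> norm_num
  have h0 := hgen.phi_pos hh
  have h0n := fun n => (hgenn n).phi_pos hh
  have hc : ∀ n, 0 < φn n (1/2) / φ (1/2) := fun n => div_pos (h0n n) h0
  have hφ : ∀ u ∈ Ioo (0:ℝ) 1,
      Tendsto (fun n => φn n u / (φn n (1/2) / φ (1/2))) atTop (𝓝 (φ u)) := by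
    intro u hu
    have := (ratio_conv hgen hgenn hconv hu hh).mul_const (φ (1/2))
    rw [div_mul_cancel₀ _ h0.ne'] at this
    refine this.congr fun n => ?_
    rw [div_div_eq_mul_div, mul_div_right_comm]
  refine ⟨fun n => φn n (1/2) / φ (1/2), hc, hφ, ?_⟩
  intro z hz
  have hψ1 : ψ z < 1 := by
    rw [← hgen.1.at_zero]
    exact hgen.strictAnti (show (0:ℝ) ≤ 0 from le_rfl) hz.le hz
  have hψ0 := hgen.2.1 z hz.le
  rw [tendsto_order]
  constructor
  · intro a ha
    rcases lt_or_ge a 0 with h | h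
    · exact Eventually.of_forall fun n => h.trans ((hgenn n).2.1 _ (mul_pos (hc n) hz).le)
    obtain ⟨b, hb1, hb2⟩ := exists_between ha
    have hb : b ∈ Ioo (0:ℝ) 1 := ⟨by linarith, by linarith⟩
    have hlt : z < φ b := by
      by_contra hcon
      push Not at hcon
      have := hgen.1.antitoneOn (hgen.phi_pos hb).le hz.le hcon
      rw [hgen.1.eta_xi b hb.1 hb.2.le] at this
      linarith
    filter_upwards [(hφ b hb).eventually (lt_mem_nhds hlt)] with n hn
    rw [lt_div_iff₀ (hc n)] at hn
    have := (hgenn n).1.antitoneOn (mul_pos (hc n) hz).le ((hgenn n).phi_pos hb).le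
      (by linarith)
    rw [(hgenn n).1.eta_xi b hb.1 hb.2.le] at this
    linarith
  · intro a ha
    rcases lt_or_ge 1 a with h | h
    · exact Eventually.of_forall fun n =>
        ((hgenn n).le_one (mul_pos (hc n) hz).le).trans_lt h
    obtain ⟨b, hb1, hb2⟩ := exists_between ha
    have hb : b ∈ Ioo (0:ℝ) 1 := ⟨by linarith, by linarith⟩
    have hlt : φ b < z := by
      by_contra hcon
      push Not at hcon
      have := hgen.1.antitoneOn hz.le (hgen.phi_pos hb).le hcon
      rw [hgen.1.eta_xi b hb.1 hb.2.le] at this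
      linarith
    filter_upwards [(hφ b hb).eventually (gt_mem_nhds hlt)] with n hn
    rw [div_lt_iff₀ (hc n)] at hn
    have := (hgenn n).1.antitoneOn ((hgenn n).phi_pos hb).le (mul_pos (hc n) hz).le
      (by linarith)
    rw [(hgenn n).1.eta_xi b hb.1 hb.2.le] at this
    linarith

end conv

/-- A normalised conditional generator together with its chain of derivatives and inverse. -/
structure GenData (m : ℕ) (g : ℕ → ℝ → ℝ) (p : ℝ → ℝ) : Prop where
  chain : GChain (Ici 0) (m + 1) g
  anti : ∀ k ≤ m + 1, Antitone (g k)
  zero : g 0 0 = 1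
  p_nonneg : ∀ u ∈ Ioc (0:ℝ) 1, 0 ≤ p u
  g_p : ∀ u ∈ Ioc (0:ℝ) 1, g 0 (p u) = u

lemma GChain.strictAnti {N : ℕ} {g : ℕ → ℝ → ℝ} (h : GChain (Ici 0) N g) (hN : 0 < N) :
    StrictAntiOn (g 0) (Ici 0) := by
  intro a ha b hb hab
  have h1 := (h.sec 0 hN a b ha hab.le).1
  have h2 := h.pos 1 hN b hb
  have : 0 < (b - a) * g 1 b := mul_pos (by linarith) h2
  simp only [zero_add] at h1
  linarith

lemma pseudoInv_apply {G : ℝ → ℝ} (hG : StrictAntiOn G (Ici 0)) {z : ℝ} (hz : 0 ≤ z) :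
    pseudoInv G (G z) = z := by
  unfold pseudoInv
  have : {y | 0 ≤ y ∧ G y ≤ G z} = Ici z := by
    ext y
    constructor
    · rintro ⟨h1, h2⟩
      by_contra hcon
      have := hG h1 hz (not_le.1 hcon)
      linarith
    · intro h
      have h1 : 0 ≤ y := hz.trans h
      exact ⟨h1, hG.antitoneOn hz h1 h⟩
  rw [this, csInf_Ici]

lemma exists_genData {l m : ℕ} (hl : 1 ≤ l) {ψ φ : ℝ → ℝ}
    (hgen : IsStrictGenerator (l + m + 2) ψ φ) {c : ℝ} (hc : 0 < c)
    {x : Fin l → ℝ} (hx : ∀ i, x i ∈ Ioo (0:ℝ) 1) :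
    GenData m (shiftChain (fun k z => c ^ k * fchain ψ (l + m) k (c * z)) l ((∑ i, φ (x i)) / c))
      (fun u => pseudoInv (psiX ψ φ x) u / c) ∧
    ∀ (s : Fin (m + 1) → ℝ) (t : ℝ), (∀ j, s j ∈ Ioc (0:ℝ) 1) → t ∈ Ioc (0:ℝ) 1 →
      condCop ψ φ x (Fin.snoc s t : Fin (m + 2) → ℝ) =
        shiftChain (fun k z => c ^ k * fchain ψ (l + m) k (c * z)) l ((∑ i, φ (x i)) / c) 0
        ((∑ j, pseudoInv (psiX ψ φ x) (s j) / c) + pseudoInv (psiX ψ φ x) t / c) := by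
  have hσ : 0 < ∑ i, φ (x i) := by
    have : Nonempty (Fin l) := ⟨⟨0, hl⟩⟩
    exact Finset.sum_pos (fun i _ => hgen.phi_pos (hx i)) Finset.univ_nonempty
  have hσc : 0 < (∑ i, φ (x i)) / c := div_pos hσ hc
  have hch : GChain (Ioi 0) (l + (m + 1)) (fchain ψ (l + m)) := gchain_of_generator hgen
  have hch2 := hch.scale hc
  set g := shiftChain (fun k z => c ^ k * fchain ψ (l + m) k (c * z)) l ((∑ i, φ (x i)) / c) with hg
  have hch3 : GChain (Ici 0) (m + 1) g := hch2.shift hσc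
  have hne : iteratedDeriv l ψ (∑ i, φ (x i)) ≠ 0 := by
    have := hch.pos l (by omega) _ hσ
    rw [fchain_le ψ (by omega)] at this
    intro h0
    rw [h0] at this; simp at this
  have hpg : ∀ z, 0 ≤ z → psiX ψ φ x (c * z) = g 0 z := by
    intro z hz
    simp only [hg, shiftChain, psiX, add_zero, max_eq_left hz]
    rw [fchain_le ψ (by omega), fchain_le ψ (by omega), mul_add, mul_div_cancel₀ _ hc.ne']
    have h1 : (-1:ℝ)^l ≠ 0 := by simp
    have h2 : c ^ l ≠ 0 := by positivity
    field_simp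
  have hpg' : ∀ z, 0 ≤ z → psiX ψ φ x z = g 0 (z / c) := by
    intro z hz
    rw [← hpg _ (by positivity), mul_div_cancel₀ _ hc.ne']
  have hsa : StrictAntiOn (psiX ψ φ x) (Ici 0) := by
    intro a ha b hb hab
    have ha' : (0:ℝ) ≤ a := ha
    have hb' : (0:ℝ) ≤ b := hb
    rw [hpg' a ha, hpg' b hb]
    exact hch3.strictAnti (by omega) (show (0:ℝ) ≤ _ by positivity) (show (0:ℝ) ≤ _ by positivity)
      (by gcongr)
  have hg0 : g 0 0 = 1 := by
    exact GChain.shift_zero (N := m + 1) hch2 hσc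
  -- surjectivity
  have hcont : Continuous (g 0) := by
    have h1 : ∀ w : ℝ, 0 < w →
        ContinuousAt (fun z => c ^ l * fchain ψ (l + m) l (c * z)) w :=
      fun w hw => hch2.lip (by omega) hw
    rw [continuous_iff_continuousAt]
    intro z
    have h2 : ContinuousAt (fun z : ℝ => (∑ i, φ (x i)) / c + max z 0) z := by fun_prop
    have h3 := h1 ((∑ i, φ (x i)) / c + max z 0) (by positivity)
    exact (ContinuousAt.comp (f := fun z : ℝ => (∑ i, φ (x i)) / c + max z 0) h3 h2).div_const _
  have hsurj : ∀ u ∈ Ioc (0:ℝ) 1, ∃ z, 0 ≤ z ∧ g 0 z = u := by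
    intro u hu
    obtain ⟨b, hb1, hb2⟩ := (((hch3.lim 0 (by omega)).eventually (gt_mem_nhds hu.1)).and
      (eventually_ge_atTop 0)).exists
    have := intermediate_value_Icc' hb2 hcont.continuousOn
    obtain ⟨z, hz, hzu⟩ := this ⟨hb1.le, by rw [hg0]; exact hu.2⟩
    exact ⟨z, hz.1, hzu⟩
  have hp : ∀ u ∈ Ioc (0:ℝ) 1, 0 ≤ pseudoInv (psiX ψ φ x) u / c ∧
      g 0 (pseudoInv (psiX ψ φ x) u / c) = u := by
    intro u hu
    obtain ⟨z, hz, rfl⟩ := hsurj u hu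
    rw [← hpg z hz, pseudoInv_apply hsa (by positivity), mul_div_cancel_left₀ _ hc.ne']
    exact ⟨hz, (hpg z hz).symm⟩
  refine ⟨⟨hch3, fun k hk => GChain.shift_antitone (N := m + 1) hch2 hσc k hk, hg0,
    fun u hu => (hp u hu).1, fun u hu => (hp u hu).2⟩, ?_⟩
  intro s t hs ht
  unfold condCop
  rw [if_neg, Fin.sum_univ_castSucc]
  · simp only [Fin.snoc_castSucc, Fin.snoc_last]
    rw [hpg', add_div, Finset.sum_div]
    have h1 : ∀ u ∈ Ioc (0:ℝ) 1, 0 ≤ pseudoInv (psiX ψ φ x) u := by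
      intro u hu
      have := mul_nonneg (hp u hu).1 hc.le
      rwa [div_mul_cancel₀ _ hc.ne'] at this
    exact add_nonneg (Finset.sum_nonneg fun j _ => h1 _ (hs j)) (h1 t ht)
  · push Not
    intro j
    refine Fin.lastCases ?_ (fun i => ?_) j
    · simpa using ht.1
    · simpa using (hs i).1

/-- reduction to normalised generators -/
lemma reduction {l m : ℕ} (hl : 1 ≤ l)
    {ψ φ : ℝ → ℝ} (hgen : IsStrictGenerator (l + m + 2) ψ φ)
    {ψn φn : ℕ → ℝ → ℝ} (hgenn : ∀ n, IsStrictGenerator (l + m + 2) (ψn n) (φn n))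
    (hconv : TendstoUniformlyOn (fun n => archCopF (ψn n) (φn n))
      (archCopF ψ φ (k := l + m + 2)) atTop (unitCube (l + m + 2)))
    {x : Fin l → ℝ} (hx : ∀ i, x i ∈ Ioo (0:ℝ) 1) :
    ∃ (g : ℕ → ℝ → ℝ) (p : ℝ → ℝ) (gn : ℕ → ℕ → ℝ → ℝ) (pn : ℕ → ℝ → ℝ),
      GenData m g p ∧ (∀ n, GenData m (gn n) (pn n)) ∧
      (∀ z, 0 ≤ z → Tendsto (fun n => gn n 0 z) atTop (𝓝 (g 0 z))) ∧
      (∀ (s : Fin (m + 1) → ℝ) (t : ℝ), (∀ j, s j ∈ Ioc (0:ℝ) 1) → t ∈ Ioc (0:ℝ) 1 →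
        condCop ψ φ x (Fin.snoc s t : Fin (m + 2) → ℝ) = g 0 ((∑ j, p (s j)) + p t)) ∧
      (∀ n, ∀ (s : Fin (m + 1) → ℝ) (t : ℝ), (∀ j, s j ∈ Ioc (0:ℝ) 1) → t ∈ Ioc (0:ℝ) 1 →
        condCop (ψn n) (φn n) x (Fin.snoc s t : Fin (m + 2) → ℝ)
          = gn n 0 ((∑ j, pn n (s j)) + pn n t)) := by
  obtain ⟨c, hc, hφ, hψ⟩ := exists_norm hgen hgenn hconv
  have h1 := exists_genData hl hgen one_pos hx
  have hn := fun n => exists_genData hl (hgenn n) (hc n) hx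
  refine ⟨_, _, _, _, h1.1, fun n => (hn n).1, ?_, h1.2, fun n => (hn n).2⟩
  intro z hz
  have hσ : 0 < ∑ i, φ (x i) := by
    have : Nonempty (Fin l) := ⟨⟨0, hl⟩⟩
    exact Finset.sum_pos (fun i _ => hgen.phi_pos (hx i)) Finset.univ_nonempty
  have hch : GChain (Ioi 0) (l + m + 1) _ := (gchain_of_generator hgen).scale one_pos
  have hchn : ∀ n, GChain (Ioi 0) (l + m + 1) _ := fun n =>
    (gchain_of_generator (hgenn n)).scale (hc n)
  have hcc := chain_conv hchn hch (by
    intro z hz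
    simp only [fchain_le _ (Nat.zero_le _)]
    simpa using hψ z hz) l (by omega)
  have hσn : Tendsto (fun n => (∑ i, φn n (x i)) / c n) atTop (𝓝 ((∑ i, φ (x i)) / 1)) := by
    simp only [Finset.sum_div, div_one]
    exact tendsto_finsetSum _ fun i _ => hφ _ (hx i)
  have hσ1 : 0 < (∑ i, φ (x i)) / 1 := by simpa using hσ
  have hl' : l < l + m + 1 := by omega
  unfold shiftChain
  simp only [add_zero]
  refine Tendsto.div ?_ ?_ (hch.pos l (by omega) _ hσ1).ne'
  · exact hcc _ _ (by positivity) (hσn.add_const _) (hch.lip hl' (by positivity))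
  · exact hcc _ _ hσ1 hσn (hch.lip hl' hσ1)
section oneD
variable {N : ℕ} {g : ℕ → ℝ → ℝ}

lemma GChain.hasDeriv (h : GChain (Ici 0) N g) {k : ℕ} (hk : k < N) {w : ℝ} (hw : 0 < w)
    (hc : ContinuousAt (g (k + 1)) w) : HasDerivAt (fun z => -(g k z)) (g (k + 1) w) w := by
  rw [hasDerivAt_iff_tendsto_slope]
  rw [tendsto_iff_dist_tendsto_zero]
  have h0 : Tendsto (fun z => dist (g (k+1) z) (g (k+1) w)) (𝓝[≠] w) (𝓝 0) :=
    (tendsto_iff_dist_tendsto_zero.1 hc.tendsto).mono_left nhdsWithin_le_nhds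
  refine squeeze_zero' (Eventually.of_forall fun z => dist_nonneg) ?_ h0
  filter_upwards [self_mem_nhdsWithin, mem_nhdsWithin_of_mem_nhds (lt_mem_nhds hw)] with z hz hz0
  rw [slope_def_field, Real.dist_eq, Real.dist_eq]
  rcases lt_or_gt_of_ne (show z ≠ w from hz) with hlt | hlt
  · have h1 := h.sec k hk z w (show (0:ℝ) ≤ z from le_of_lt hz0) hlt.le
    have hd : 0 < w - z := by linarith
    have e : (-(g k z) - -(g k w)) / (z - w) = (g k z - g k w) / (w - z) := by
      rw [← neg_sub w z, div_neg, ← neg_div]; ring_nf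
    have h2 : g (k+1) w ≤ (g k z - g k w) / (w - z) := by rw [le_div_iff₀ hd]; linarith
    have h3 : (g k z - g k w) / (w - z) ≤ g (k+1) z := by rw [div_le_iff₀ hd]; linarith
    rw [e, abs_of_nonneg (by linarith), abs_of_nonneg (by linarith)]
    linarith
  · have h1 := h.sec k hk w z (show (0:ℝ) ≤ w from le_of_lt hw) hlt.le
    have hd : 0 < z - w := by linarith
    have h2 : g (k+1) z ≤ (-(g k z) - -(g k w)) / (z - w) := by rw [le_div_iff₀ hd]; linarith
    have h3 : (-(g k z) - -(g k w)) / (z - w) ≤ g (k+1) w := by rw [div_le_iff₀ hd]; linarith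
    rw [abs_of_nonpos (by linarith), abs_of_nonpos (by linarith)]
    linarith

lemma GChain.lipAbs (h : GChain (Ici 0) N g) {k : ℕ} (hk : k < N) {a b : ℝ} (ha : 0 ≤ a)
    (hb : 0 ≤ b) : |g k a - g k b| ≤ g (k + 1) 0 * |a - b| := by
  have aux : ∀ {a b : ℝ}, 0 ≤ a → a ≤ b → |g k a - g k b| ≤ g (k + 1) 0 * |a - b| := by
    intro a b ha hab
    have h1 := (h.sec k hk a b ha hab).2
    have h2 := h.anti k hk.le ha (ha.trans hab : (0:ℝ) ≤ b) hab
    have h3 := h.anti (k+1) hk (show (0:ℝ) ≤ 0 from le_rfl) ha ha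
    rw [abs_of_nonneg (by linarith), abs_of_nonpos (by linarith)]
    have : (b - a) * g (k+1) a ≤ (b - a) * g (k+1) 0 := mul_le_mul_of_nonneg_left h3 (by linarith)
    linarith
  rcases le_total a b with hab | hab
  · exact aux ha hab
  · rw [abs_sub_comm, abs_sub_comm a]
    exact aux hb hab

lemma GChain.contOn (h : GChain (Ici 0) N g) {k : ℕ} (hk : k < N) : ContinuousOn (g k) (Ici 0) := by
  have : LipschitzOnWith (Real.toNNReal (g (k+1) 0)) (g k) (Ici 0) := by
    refine LipschitzOnWith.of_dist_le_mul ?_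
    intro a ha b hb
    rw [Real.coe_toNNReal _ (h.pos (k+1) hk 0 (show (0:ℝ) ≤ 0 from le_rfl)).le]
    exact h.lipAbs hk ha hb
  exact this.continuousOn

lemma GChain.ftc (h : GChain (Ici 0) N g) {k : ℕ} (hk : k < N) (hanti : Antitone (g (k + 1)))
    {a b : ℝ} (ha : 0 ≤ a) (hab : a ≤ b) :
    ∫ z in a..b, g (k + 1) z = g k a - g k b := by
  have := integral_eq_of_hasDerivAt_off_countable_of_le (fun z => -(g k z)) (g (k+1)) hab
    hanti.countable_not_continuousAt
    ((h.contOn hk).neg.mono fun z hz => (ha.trans hz.1 : (0:ℝ) ≤ z))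
    (fun z hz => h.hasDeriv hk (ha.trans_lt hz.1.1) (by simpa using hz.2))
    (hanti.antitoneOn _).intervalIntegrable
  rw [this]; ring

lemma GChain.int1 (h : GChain (Ici 0) N g) {k : ℕ} (hk : k < N) (hanti : Antitone (g (k + 1)))
    {a : ℝ} (ha : 0 ≤ a) :
    ∫⁻ z in Ioi a, ENNReal.ofReal (g (k + 1) z) = ENNReal.ofReal (g k a) := by
  have hm : Measurable fun z => ENNReal.ofReal (g (k+1) z) := hanti.measurable.ennreal_ofReal
  have h1 := (aecover_Iic (μ := volume.restrict (Ioi a)) (tendsto_id (α := ℝ) (x := atTop))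
    ).lintegral_tendsto_of_countably_generated hm.aemeasurable
  refine tendsto_nhds_unique h1 ?_
  have h2 : Tendsto (fun b => ENNReal.ofReal (g k a - g k b)) atTop (𝓝 (ENNReal.ofReal (g k a))) := by
    have := (tendsto_const_nhds (x := g k a)).sub (h.lim k hk.le)
    rw [sub_zero] at this
    exact ENNReal.tendsto_ofReal this
  refine h2.congr' ?_
  filter_upwards [eventually_ge_atTop a] with b hb
  rw [Measure.restrict_restrict measurableSet_Iic]
  have e : Iic (id b) ∩ Ioi a = Ioc a b := by ext z; simp [and_comm]
  rw [e, ← ofReal_integral_eq_lintegral_ofReal, ← intervalIntegral.integral_of_le hb, h.ftc hk hanti ha hb]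
  · exact ((hanti.antitoneOn _).intervalIntegrable (a := a) (b := b)).1
  · filter_upwards [ae_restrict_mem measurableSet_Ioc] with z hz
    exact (h.pos (k+1) hk z (show (0:ℝ) ≤ z from ha.trans hz.1.le)).le

lemma GChain.int_shift (h : GChain (Ici 0) N g) {k : ℕ} (hk : k < N) (hanti : Antitone (g (k + 1)))
    {w a : ℝ} (ha : 0 ≤ w + a) :
    ∫⁻ z in Ioi a, ENNReal.ofReal (g (k + 1) (w + z)) = ENNReal.ofReal (g k (w + a)) := by
  rw [← h.int1 hk hanti ha]
  have := (measurePreserving_add_left (volume : Measure ℝ) w).setLIntegral_comp_preimage_emb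
    (measurableEmbedding_addLeft w) (fun z => ENNReal.ofReal (g (k + 1) z)) (Ioi (w + a))
  rw [← this]
  congr 2
  ext z; simp

lemma GChain.int_pi (h : GChain (Ici 0) N g) (hanti : ∀ k ≤ N, Antitone (g k)) :
    ∀ (j k : ℕ), k + j ≤ N → ∀ w : ℝ, 0 ≤ w → ∀ a : Fin j → ℝ, (∀ i, 0 ≤ a i) →
    ∫⁻ z, ENNReal.ofReal (g (k + j) (w + ∑ i, z i))
        ∂(Measure.pi fun i => (volume : Measure ℝ).restrict (Ioi (a i)))
      = ENNReal.ofReal (g k (w + ∑ i, a i)) := by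
  intro j
  induction j with
  | zero =>
    intro k hk w hw a ha
    rw [Measure.pi_of_empty]
    simp
  | succ j ih =>
    intro k hk w hw a ha
    have hmeas : Measurable (g (k + (j + 1))) := (hanti _ hk).measurable
    have e := (measurePreserving_piFinSuccAbove
      (fun i : Fin (j+1) => (volume : Measure ℝ).restrict (Ioi (a i))) 0).symm
    rw [← e.lintegral_comp (by fun_prop)]
    rw [lintegral_prod _ (by fun_prop)]
    have hin : ∀ᵐ z ∂((volume : Measure ℝ).restrict (Ioi (a 0))),
        ∫⁻ y, ENNReal.ofReal (g (k + (j + 1)) (w + ∑ i,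
          ((MeasurableEquiv.piFinSuccAbove (fun _ => ℝ) 0).symm (z, y) : Fin (j+1) → ℝ) i))
        ∂(Measure.pi fun i : Fin j => (volume : Measure ℝ).restrict (Ioi (a (Fin.succAbove 0 i))))
        = ENNReal.ofReal (g (k + 1) ((w + ∑ i : Fin j, a i.succ) + z)) := by
      filter_upwards [ae_restrict_mem measurableSet_Ioi] with z hz
      have hz0 : 0 ≤ z := (ha 0).trans (le_of_lt hz)
      have := ih (k + 1) (by omega) (w + z) (by linarith) (fun i => a i.succ) (fun i => ha _)
      rw [show w + ∑ i : Fin j, a i.succ + z = w + z + ∑ i : Fin j, a i.succ by ring, ← this]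
      simp only [Fin.zero_succAbove]
      refine lintegral_congr fun y => ?_
      rw [show k + (j + 1) = k + 1 + j by ring]
      congr 2
      simp [MeasurableEquiv.piFinSuccAbove_symm_apply, Fin.sum_univ_succ, add_assoc]
    rw [lintegral_congr_ae hin]
    have hsum : 0 ≤ ∑ i : Fin j, a i.succ := Finset.sum_nonneg fun i _ => ha _
    rw [h.int_shift (by omega) (hanti _ (by omega)) (by have := ha 0; linarith)]
    rw [Fin.sum_univ_succ]
    congr 2; ring
end oneD
lemma lowerBox_eq_pi {k : ℕ} (s : Fin k → ℝ) : lowerBox s = univ.pi fun j => Iic (s j) := by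
  ext t; simp only [lowerBox, Set.mem_pi, mem_univ, true_imp_iff, mem_Iic, mem_ofPred_eq]

lemma measurableSet_lowerBox {k : ℕ} (s : Fin k → ℝ) : MeasurableSet (lowerBox s) := by
  rw [lowerBox_eq_pi]; exact MeasurableSet.univ_pi fun _ => measurableSet_Iic

section gd
variable {m : ℕ} {g : ℕ → ℝ → ℝ} {p : ℝ → ℝ}

lemma GenData.strict (D : GenData m g p) : StrictAntiOn (g 0) (Ici 0) :=
  D.chain.strictAnti (Nat.succ_pos m)

lemma GenData.g_mem (D : GenData m g p) {z : ℝ} (hz : 0 ≤ z) : g 0 z ∈ Ioc (0:ℝ) 1 := by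
  refine ⟨D.chain.pos 0 (Nat.zero_le _) z hz, ?_⟩
  rw [← D.zero]; exact D.anti 0 (Nat.zero_le _) hz

lemma GenData.p_g (D : GenData m g p) {z : ℝ} (hz : 0 ≤ z) : p (g 0 z) = z :=
  D.strict.injOn (D.p_nonneg _ (D.g_mem hz)) hz (D.g_p _ (D.g_mem hz))

lemma GenData.p_one (D : GenData m g p) : p 1 = 0 := by
  have := D.p_g le_rfl
  rwa [D.zero] at this

lemma GenData.p_antitone (D : GenData m g p) : AntitoneOn p (Ioc 0 1) := by
  intro a ha b hb hab
  by_contra h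
  push Not at h
  have := D.strict (D.p_nonneg _ ha) (D.p_nonneg _ hb) h
  rw [D.g_p _ ha, D.g_p _ hb] at this
  linarith

lemma GenData.g_le_iff (D : GenData m g p) {z s : ℝ} (hz : 0 ≤ z) (hs : s ∈ Ioc (0:ℝ) 1) :
    g 0 z ≤ s ↔ p s ≤ z := by
  conv_lhs => rw [← D.g_p s hs]
  exact D.strict.le_iff_ge hz (D.p_nonneg s hs)

lemma GenData.exists_meas (D : GenData m g p) : ∃ p', Measurable p' ∧ GenData m g p' ∧
    ∀ u ∈ Ioc (0:ℝ) 1, p' u = p u := by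
  have hM : Monotone (fun u : ℝ => if u ≤ 0 then (0:ℝ) else 1 / (1 + p (min u 1))) := by
    intro a b hab
    dsimp only
    by_cases hb : b ≤ 0
    · rw [if_pos hb, if_pos (hab.trans hb)]
    · push Not at hb
      rw [if_neg (not_le.2 hb)]
      have hb' : min b 1 ∈ Ioc (0:ℝ) 1 := ⟨lt_min hb one_pos, min_le_right _ _⟩
      have h0 := D.p_nonneg _ hb'
      by_cases ha : a ≤ 0
      · rw [if_pos ha]; positivity
      · push Not at ha
        rw [if_neg (not_le.2 ha)]
        have ha' : min a 1 ∈ Ioc (0:ℝ) 1 := ⟨lt_min ha one_pos, min_le_right _ _⟩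
        have := D.p_antitone ha' hb' (min_le_min_right 1 hab)
        apply one_div_le_one_div_of_le (by linarith)
        linarith
  have h : ∀ u ∈ Ioc (0:ℝ) 1,
      1 / (if u ≤ 0 then (0:ℝ) else 1 / (1 + p (min u 1))) - 1 = p u := by
    intro u hu
    rw [if_neg (not_le.2 hu.1), min_eq_left hu.2, one_div_one_div]; ring
  refine ⟨fun u => 1 / (if u ≤ 0 then (0:ℝ) else 1 / (1 + p (min u 1))) - 1, ?_, ?_, h⟩
  · exact (hM.measurable.const_div 1).sub_const 1
  · exact ⟨D.chain, D.anti, D.zero, fun u hu => by rw [h u hu]; exact D.p_nonneg u hu,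
      fun u hu => by rw [h u hu]; exact D.g_p u hu⟩

/-- Lebesgue measure on the open positive orthant. -/
def posMeas (m : ℕ) : Measure (Fin (m + 1) → ℝ) :=
  Measure.pi (fun _ : Fin (m + 1) => volume.restrict (Ioi (0:ℝ)))

lemma posMeas_eq : posMeas m = volume.restrict (univ.pi fun _ => Ioi (0:ℝ)) := by
  rw [posMeas, volume_pi, Measure.restrict_pi_pi]

lemma posMeas_ae : ∀ᵐ z ∂(posMeas m), ∀ j, 0 < z j := by
  rw [posMeas_eq]
  filter_upwards [ae_restrict_mem (MeasurableSet.univ_pi fun _ => measurableSet_Ioi)] with z hz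
  exact fun j => hz j (mem_univ j)

instance : SigmaFinite (posMeas m) := by unfold posMeas; infer_instance

/-- The coordinatewise transform. -/
def Phi (m : ℕ) (g : ℕ → ℝ → ℝ) (z : Fin (m + 1) → ℝ) : Fin (m + 1) → ℝ := fun j => g 0 (z j)

/-- The density of the conditional law. -/
def dens (m : ℕ) (g : ℕ → ℝ → ℝ) (b : ℝ) (z : Fin (m + 1) → ℝ) : ℝ≥0∞ :=
  ENNReal.ofReal (g (m + 1) (b + ∑ i, z i))

lemma GenData.meas_top (D : GenData m g p) : Measurable (g (m + 1)) :=
  (D.anti (m + 1) le_rfl).measurable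

lemma GenData.meas_Phi (D : GenData m g p) : Measurable (Phi m g) :=
  measurable_pi_lambda _ fun j => (D.anti 0 (Nat.zero_le _)).measurable.comp (measurable_pi_apply j)

lemma GenData.meas_dens (D : GenData m g p) (b : ℝ) : Measurable (dens m g b) :=
  (D.meas_top.comp ((Finset.measurable_sum _ fun i _ => measurable_pi_apply i).const_add b)).ennreal_ofReal

lemma GenData.box (D : GenData m g p) {b : ℝ} (hb : 0 ≤ b) {s : Fin (m + 1) → ℝ}
    (hs : ∀ j, s j ∈ Ioc (0:ℝ) 1) :
    (((posMeas m).withDensity (dens m g b)).map (Phi m g)) (lowerBox s)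
      = ENNReal.ofReal (g 0 (b + ∑ j, p (s j))) := by
  have hbox : MeasurableSet (lowerBox s) := measurableSet_lowerBox s
  rw [Measure.map_apply D.meas_Phi hbox, withDensity_apply _ (D.meas_Phi hbox)]
  have h1 : (posMeas m).restrict (Phi m g ⁻¹' lowerBox s)
      = Measure.pi fun j => volume.restrict (Ioi (p (s j))) := by
    rw [← Measure.restrict_pi_pi, ← volume_pi, posMeas_eq, Measure.restrict_restrict (D.meas_Phi hbox)]
    have e1 : (Phi m g ⁻¹' lowerBox s ∩ univ.pi fun _ => Ioi (0:ℝ))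
       = univ.pi fun j => {z | g 0 z ≤ s j} ∩ Ioi 0 := by
      ext z; simp [Phi, lowerBox, forall_and]
    rw [e1, volume_pi]
    apply Measure.restrict_congr_set
    apply Measure.ae_eq_set_pi
    intro j _
    have : {z | g 0 z ≤ s j} ∩ Ioi 0 = Ici (p (s j)) ∩ Ioi 0 := by
      ext z
      simp only [mem_inter_iff, mem_ofPred_eq, mem_Ici, mem_Ioi, and_congr_left_iff]
      intro hz; exact D.g_le_iff hz.le (hs j)
    rw [this]
    have h2 : (Ici (p (s j)) ∩ Ioi 0 : Set ℝ) =ᵐ[volume] (Ioi (p (s j)) ∩ Ioi 0 : Set ℝ) :=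
      Ioi_ae_eq_Ici.symm.inter (ae_eq_refl _)
    refine h2.trans ?_
    have h3 : Ioi (p (s j)) ∩ Ioi 0 = Ioi (p (s j)) :=
      inter_eq_left.2 (fun z hz => lt_of_le_of_lt (D.p_nonneg _ (hs j)) hz)
    exact Filter.EventuallyEq.of_eq h3
  rw [h1]
  have := D.chain.int_pi D.anti (m + 1) 0 (by omega) b hb (fun j => p (s j))
    (fun j => D.p_nonneg _ (hs j))
  rw [Nat.zero_add] at this
  exact this

end gd
lemma ext_box {m : ℕ} {μ₁ μ₂ : Measure (Fin (m + 1) → ℝ)} [IsFiniteMeasure μ₁]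
    (h₁ : ∀ᵐ s ∂μ₁, ∀ j, s j ∈ Ioc (0:ℝ) 1) (h₂ : ∀ᵐ s ∂μ₂, ∀ j, s j ∈ Ioc (0:ℝ) 1)
    (h : ∀ s : Fin (m + 1) → ℝ, (∀ j, s j ∈ Ioc (0:ℝ) 1) → μ₁ (lowerBox s) = μ₂ (lowerBox s)) :
    μ₁ = μ₂ := by
  have key : ∀ (μ : Measure (Fin (m + 1) → ℝ)), (∀ᵐ s ∂μ, ∀ j, s j ∈ Ioc (0:ℝ) 1) →
      ∀ s : Fin (m + 1) → ℝ, (∀ j, 0 < s j) →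
      μ (lowerBox s) = μ (lowerBox fun j => min (s j) 1) := by
    intro μ hμ s _
    apply measure_congr
    filter_upwards [hμ] with t ht
    apply propext
    change (∀ i, t i ≤ s i) ↔ (∀ i, t i ≤ min (s i) 1)
    exact forall_congr' fun i => ⟨fun hi => le_min hi (ht i).2, fun hi => hi.trans (min_le_left _ _)⟩
  have key0 : ∀ (μ : Measure (Fin (m + 1) → ℝ)), (∀ᵐ s ∂μ, ∀ j, s j ∈ Ioc (0:ℝ) 1) →
      ∀ s : Fin (m + 1) → ℝ, (¬ ∀ j, 0 < s j) → μ (lowerBox s) = 0 := by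
    intro μ hμ s hs
    push Not at hs
    obtain ⟨j, hj⟩ := hs
    apply measure_eq_zero_iff_ae_notMem.2
    filter_upwards [hμ] with t ht hts
    exact absurd ((ht j).1.trans_le ((hts j).trans hj)) (lt_irrefl _)
  have hall : ∀ s : Fin (m + 1) → ℝ, μ₁ (lowerBox s) = μ₂ (lowerBox s) := by
    intro s
    by_cases hs : ∀ j, 0 < s j
    · rw [key _ h₁ s hs, key _ h₂ s hs]
      exact h _ fun j => ⟨lt_min (hs j) one_pos, min_le_right _ _⟩
    · rw [key0 _ h₁ s hs, key0 _ h₂ s hs]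
  refine ext_of_generate_finite (Set.pi univ '' Set.pi univ fun _ : Fin (m + 1) => range (Iic : ℝ → Set ℝ))
    (generateFrom_eq_pi (fun i => ?_) (fun i => ?_)).symm (IsPiSystem.pi fun i => isPiSystem_Iic) ?_ ?_
  · rw [← borel_eq_generateFrom_Iic, BorelSpace.measurable_eq (α := ℝ)]
  · refine ⟨fun n => Iic (n:ℝ), fun n => ⟨_, rfl⟩, ?_⟩
    exact iUnion_Iic_of_not_bddAbove_range (by
      rintro ⟨b, hb⟩
      obtain ⟨n, hn⟩ := exists_nat_gt b
      exact absurd (hb ⟨n, rfl⟩) (not_le.2 hn))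
  · rintro _ ⟨f, hf, rfl⟩
    choose s hs using fun j => hf j (mem_univ j)
    have := hall s
    rw [lowerBox_eq_pi] at this
    have e : f = fun j => Iic (s j) := funext fun j => (hs j).symm
    rwa [← e] at this
  · have e1 : ∀ (μ : Measure (Fin (m + 1) → ℝ)), (∀ᵐ s ∂μ, ∀ j, s j ∈ Ioc (0:ℝ) 1) →
        μ univ = μ (lowerBox fun _ => 1) := by
      intro μ hμ
      apply measure_congr
      filter_upwards [hμ] with t ht
      apply propext
      change True ↔ (∀ i, t i ≤ 1)
      exact ⟨fun _ i => (ht i).2, fun _ => trivial⟩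
    rw [e1 _ h₁, e1 _ h₂, hall]

/-- All the data of a conditional copula in transformed coordinates. -/
structure CopData (m : ℕ) (g : ℕ → ℝ → ℝ) (p : ℝ → ℝ) (μ : Measure ((Fin (m + 1) → ℝ) × ℝ))
    (K : Kernel (Fin (m + 1) → ℝ) ℝ) : Prop where
  D : GenData m g p
  pm : Measurable p
  prob : IsProbabilityMeasure μ
  cube : μ ((unitCube (m + 1)) ×ˢ Icc (0:ℝ) 1) = 1
  box : ∀ (s : Fin (m + 1) → ℝ) (t : ℝ), (∀ j, s j ∈ Ioc (0:ℝ) 1) → t ∈ Ioc (0:ℝ) 1 →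
      μ (lowerBox s ×ˢ Iic t) = ENNReal.ofReal (g 0 ((∑ j, p (s j)) + p t))
  markov : IsMarkovKernel K
  dis : IsDisintegration μ K

section cd
variable {m : ℕ} {g : ℕ → ℝ → ℝ} {p : ℝ → ℝ} {μ : Measure ((Fin (m + 1) → ℝ) × ℝ)}
    {K : Kernel (Fin (m + 1) → ℝ) ℝ}

lemma measurableSet_unitCube (k : ℕ) : MeasurableSet (unitCube k) := by
  have : unitCube k = univ.pi fun _ => Icc (0:ℝ) 1 := by
    ext t; simp only [unitCube, Set.mem_pi, mem_univ, true_imp_iff, mem_ofPred_eq]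
  rw [this]; exact MeasurableSet.univ_pi fun _ => measurableSet_Icc

lemma CopData.ae_cube (C : CopData m g p μ K) :
    ∀ᵐ q ∂μ, (∀ j, q.1 j ∈ Icc (0:ℝ) 1) ∧ q.2 ∈ Icc (0:ℝ) 1 := by
  have := C.prob
  have h := (mem_ae_iff_prob_eq_one ((measurableSet_unitCube (m + 1)).prod measurableSet_Icc)).2 C.cube
  filter_upwards [h] with q hq
  exact ⟨hq.1, hq.2⟩

lemma CopData.ae_pos (C : CopData m g p μ K) (j : Fin (m + 1)) : ∀ᵐ q ∂μ, 0 < q.1 j := by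
  have := C.prob
  have hle : ∀ ε : ℝ, ε ∈ Ioc (0:ℝ) 1 → μ {q | q.1 j ≤ 0} ≤ ENNReal.ofReal ε := by
    intro ε hε
    set s : Fin (m + 1) → ℝ := Function.update (fun _ => 1) j ε with hs
    have hs' : ∀ i, s i ∈ Ioc (0:ℝ) 1 := by
      intro i
      by_cases hi : i = j
      · subst hi; simpa [hs] using hε
      · simp [hs, hi]
    have hb := C.box s 1 hs' ⟨one_pos, le_rfl⟩
    have hsum : ∑ i, p (s i) = p ε := by
      rw [Finset.sum_eq_single j]
      · simp [hs]
      · intro i _ hi; simp [hs, hi, C.D.p_one]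
      · simp
    rw [hsum, C.D.p_one, add_zero, C.D.g_p ε hε] at hb
    rw [← hb]
    apply measure_mono_ae
    filter_upwards [C.ae_cube] with q hq hq0
    refine ⟨fun i => ?_, hq.2.2⟩
    by_cases hi : i = j
    · subst hi
      have : q.1 i ≤ 0 := hq0
      simp only [hs, Function.update_self]; linarith [hε.1]
    · simp only [hs, Function.update_of_ne hi]; exact (hq.1 i).2
  have h0 : μ {q | q.1 j ≤ 0} = 0 := by
    refine le_antisymm (ge_of_tendsto (x := 𝓝[>] (0:ℝ)) (f := fun ε => ENNReal.ofReal ε) ?_ ?_) bot_le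
    · have := (ENNReal.continuous_ofReal.tendsto (0:ℝ)).mono_left (nhdsWithin_le_nhds (s := Ioi 0))
      simpa using this
    · filter_upwards [Ioc_mem_nhdsGT one_pos] with ε hε using hle ε hε
  have := measure_eq_zero_iff_ae_notMem.1 h0
  filter_upwards [this] with q hq
  exact not_le.1 hq

lemma CopData.ae_Ioc (C : CopData m g p μ K) :
    ∀ᵐ q ∂μ, ∀ j, q.1 j ∈ Ioc (0:ℝ) 1 := by
  filter_upwards [C.ae_cube, ae_all_iff.2 C.ae_pos] with q h1 h2 j
  exact ⟨h2 j, (h1.1 j).2⟩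

lemma measurableSet_Ioc_pi (m : ℕ) : MeasurableSet {s : Fin (m + 1) → ℝ | ∀ j, s j ∈ Ioc (0:ℝ) 1} := by
  have : {s : Fin (m + 1) → ℝ | ∀ j, s j ∈ Ioc (0:ℝ) 1} = univ.pi fun _ => Ioc (0:ℝ) 1 := by
    ext t; simp only [Set.mem_pi, mem_univ, true_imp_iff, mem_ofPred_eq]
  rw [this]; exact MeasurableSet.univ_pi fun _ => measurableSet_Ioc

lemma CopData.ident (C : CopData m g p μ K) {t : ℝ} (ht : t ∈ Ioc (0:ℝ) 1) :
    (μ.restrict (univ ×ˢ Iic t)).map Prod.fst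
      = ((posMeas m).withDensity (dens m g (p t))).map (Phi m g) := by
  have := C.prob
  have hT : MeasurableSet ((univ : Set (Fin (m + 1) → ℝ)) ×ˢ Iic t) := MeasurableSet.univ.prod measurableSet_Iic
  have : IsFiniteMeasure ((μ.restrict (univ ×ˢ Iic t)).map (Prod.fst : _ → (Fin (m + 1) → ℝ))) := by
    infer_instance
  apply ext_box
  · rw [ae_map_iff measurable_fst.aemeasurable (measurableSet_Ioc_pi m)]
    exact ae_restrict_of_ae C.ae_Ioc
  · rw [ae_map_iff C.D.meas_Phi.aemeasurable (measurableSet_Ioc_pi m)]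
    refine (withDensity_absolutelyContinuous _ _).ae_le ?_
    filter_upwards [posMeas_ae] with z hz j
    exact C.D.g_mem (hz j).le
  · intro s hs
    rw [C.D.box (C.D.p_nonneg t ht) hs, Measure.map_apply measurable_fst (measurableSet_lowerBox s),
      Measure.restrict_apply (measurable_fst (measurableSet_lowerBox s)), add_comm (p t), ← C.box s t hs ht]
    congr 1
    ext q; simp [Set.mem_prod]

lemma CopData.ident_one (C : CopData m g p μ K) :
    μ.map Prod.fst = ((posMeas m).withDensity (dens m g 0)).map (Phi m g) := by
  have h := C.ident (t := 1) ⟨one_pos, le_rfl⟩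
  rw [C.D.p_one] at h
  rw [← h]
  congr 1
  symm
  apply Measure.restrict_eq_self_of_ae_mem
  filter_upwards [C.ae_cube] with q hq
  exact ⟨mem_univ _, hq.2.2⟩

/-- The explicit Markov kernel. -/
def kerF (m : ℕ) (g : ℕ → ℝ → ℝ) (p : ℝ → ℝ) (t : ℝ) (s : Fin (m + 1) → ℝ) : ℝ :=
  g (m + 1) (p t + ∑ j, p (s j)) / g (m + 1) (∑ j, p (s j))

lemma CopData.meas_kerF (C : CopData m g p μ K) (t : ℝ) : Measurable (kerF m g p t) := by
  have h : Measurable fun s : Fin (m + 1) → ℝ => ∑ j, p (s j) :=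
    Finset.measurable_sum _ fun i _ => C.pm.comp (measurable_pi_apply i)
  exact (C.D.meas_top.comp (h.const_add _)).div (C.D.meas_top.comp h)

lemma CopData.sum_p_Phi (C : CopData m g p μ K) {z : Fin (m + 1) → ℝ} (hz : ∀ j, 0 < z j) :
    ∑ j, p (Phi m g z j) = ∑ j, z j :=
  Finset.sum_congr rfl fun j _ => C.D.p_g (hz j).le

lemma CopData.kernel (C : CopData m g p μ K) {t : ℝ} (ht : t ∈ Ioc (0:ℝ) 1) :
    ∀ᵐ s ∂(μ.map Prod.fst), K s (Iic t) = ENNReal.ofReal (kerF m g p t s) := by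
  have := C.prob
  have := C.markov
  have : IsProbabilityMeasure (μ.map (Prod.fst : _ → (Fin (m + 1) → ℝ))) :=
    Measure.isProbabilityMeasure_map measurable_fst.aemeasurable
  have hf := (C.meas_kerF t).ennreal_ofReal
  refine ae_eq_of_forall_setLIntegral_eq_of_sigmaFinite (K.measurable_coe measurableSet_Iic) hf ?_
  intro A hA _
  have h1 : ∫⁻ s in A, K s (Iic t) ∂(μ.map Prod.fst) = μ (A ×ˢ Iic t) := by
    rw [C.dis _ (hA.prod measurableSet_Iic), ← lintegral_indicator hA]
    apply lintegral_congr
    intro s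
    by_cases hs : s ∈ A
    · rw [indicator_of_mem hs]; congr 1; ext u; simp [hs]
    · rw [indicator_of_notMem hs]
      have : Prod.mk s ⁻¹' A ×ˢ Iic t = ∅ := by ext u; simp [hs]
      rw [this, measure_empty]
  have h2 : μ (A ×ˢ Iic t) = ((μ.restrict (univ ×ˢ Iic t)).map Prod.fst) A := by
    rw [Measure.map_apply measurable_fst hA, Measure.restrict_apply (measurable_fst hA)]
    congr 1
    ext q; simp [Set.mem_prod]
  rw [h1, h2, C.ident ht, Measure.map_apply C.D.meas_Phi hA, withDensity_apply _ (C.D.meas_Phi hA),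
    C.ident_one, setLIntegral_map hA hf C.D.meas_Phi]
  refine Eq.trans ?_ (setLIntegral_withDensity_eq_setLIntegral_mul (posMeas m) (C.D.meas_dens 0)
    (hf.comp C.D.meas_Phi) (C.D.meas_Phi hA)).symm
  apply setLIntegral_congr_fun_ae (C.D.meas_Phi hA)
  filter_upwards [posMeas_ae] with z hz _
  have hpos : 0 < g (m + 1) (∑ i, z i) :=
    C.D.chain.pos _ le_rfl _ (Finset.sum_nonneg fun i _ => (hz i).le)
  simp only [Pi.mul_apply, Function.comp_apply, dens, kerF, C.sum_p_Phi hz, zero_add]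
  rw [← ENNReal.ofReal_mul hpos.le, mul_div_cancel₀ _ hpos.ne']

lemma CopData.ae_pull (C : CopData m g p μ K) {P : (Fin (m + 1) → ℝ) → Prop}
    (h : ∀ᵐ s ∂(μ.map Prod.fst), P s) : ∀ᵐ z ∂(posMeas m), P (Phi m g z) := by
  rw [C.ident_one] at h
  have h2 := ae_of_ae_map C.D.meas_Phi.aemeasurable h
  rw [ae_withDensity_iff (C.D.meas_dens 0)] at h2
  filter_upwards [h2, posMeas_ae] with z h3 hz
  apply h3
  have hpos : 0 < g (m + 1) (∑ i, z i) :=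
    C.D.chain.pos _ le_rfl _ (Finset.sum_nonneg fun i _ => (hz i).le)
  simp only [dens, zero_add, ne_eq, ENNReal.ofReal_eq_zero, not_le]
  exact hpos

lemma CopData.ae_push (C : CopData m g p μ K) {P : (Fin (m + 1) → ℝ) → Prop}
    (hP : MeasurableSet {s | P s})
    (h : ∀ᵐ z ∂(posMeas m), P (Phi m g z)) : ∀ᵐ s ∂(μ.map Prod.fst), P s := by
  rw [C.ident_one, ae_map_iff C.D.meas_Phi.aemeasurable hP]
  exact (withDensity_absolutelyContinuous _ _).ae_le h

lemma CopData.ker_neg (C : CopData m g p μ K) :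
    ∀ᵐ s ∂(μ.map Prod.fst), K s (Icc 0 1)ᶜ = 0 := by
  have h : μ (univ ×ˢ (Icc (0:ℝ) 1)ᶜ) = 0 := by
    apply measure_eq_zero_iff_ae_notMem.2
    filter_upwards [C.ae_cube] with q hq hq2
    exact hq2.2 hq.2
  rw [C.dis _ (MeasurableSet.univ.prod measurableSet_Icc.compl)] at h
  have h2 : ∀ s : Fin (m + 1) → ℝ, Prod.mk s ⁻¹' (univ ×ˢ (Icc (0:ℝ) 1)ᶜ) = (Icc (0:ℝ) 1)ᶜ := by
    intro s; ext u; simp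
  simp only [h2] at h
  exact (lintegral_eq_zero_iff (K.measurable_coe measurableSet_Icc.compl)).1 h

end cd
section ac
variable {m : ℕ} {g g' : ℕ → ℝ → ℝ} {p p' : ℝ → ℝ}

lemma GenData.chi_lip (D : GenData m g p) (D' : GenData m g' p') {M z w : ℝ}
    (hz : z ∈ Icc 0 M) (hw : w ∈ Icc 0 M) :
    |p (g' 0 z) - p (g' 0 w)| ≤ g' 1 0 / g 1 (p (g' 0 M)) * |z - w| := by
  have hM : 0 ≤ M := hz.1.trans hz.2
  have hB := D.p_nonneg _ (D'.g_mem hM)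
  have hg1 : 0 < g 1 (p (g' 0 M)) := D.chain.pos 1 (by omega) _ hB
  have key : ∀ a b, 0 ≤ a → a ≤ b → b ≤ p (g' 0 M) →
      (b - a) * g 1 (p (g' 0 M)) ≤ g 0 a - g 0 b := by
    intro a b ha hab hb
    refine le_trans ?_ (D.chain.sec 0 (by omega) a b ha hab).1
    exact mul_le_mul_of_nonneg_left (D.anti 1 (by omega) hb) (by linarith)
  have hle : ∀ y ∈ Icc 0 M, p (g' 0 y) ≤ p (g' 0 M) := fun y hy =>
    D.p_antitone (D'.g_mem hM) (D'.g_mem hy.1) (D'.anti 0 (by omega) hy.2)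
  have h1 : |p (g' 0 z) - p (g' 0 w)| * g 1 (p (g' 0 M)) ≤ |g' 0 z - g' 0 w| := by
    have ez := D.g_p _ (D'.g_mem hz.1)
    have ew := D.g_p _ (D'.g_mem hw.1)
    have nz := D.p_nonneg _ (D'.g_mem hz.1)
    have nw := D.p_nonneg _ (D'.g_mem hw.1)
    rcases le_total (p (g' 0 z)) (p (g' 0 w)) with h | h
    · have := key _ _ nz h (hle w hw)
      rw [ez, ew] at this
      rw [abs_of_nonpos (by linarith), neg_sub]
      exact this.trans (le_abs_self _)
    · have := key _ _ nw h (hle z hz)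
      rw [ez, ew] at this
      rw [abs_of_nonneg (by linarith)]
      refine this.trans ?_
      rw [abs_sub_comm]; exact le_abs_self _
  have h2 := D'.chain.lipAbs (k := 0) (by omega) hz.1 hw.1
  rw [div_mul_eq_mul_div, le_div_iff₀ hg1]
  exact h1.trans h2

lemma GenData.ac (D : GenData m g p) (D' : GenData m g' p') {A : Set (Fin (m + 1) → ℝ)}
    (hA : MeasurableSet A) (h : posMeas m (Phi m g' ⁻¹' A) = 0) :
    posMeas m (Phi m g ⁻¹' A) = 0 := by
  rw [posMeas_eq, Measure.restrict_apply (D'.meas_Phi hA)] at h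
  rw [posMeas_eq, Measure.restrict_apply (D.meas_Phi hA)]
  set S := Phi m g' ⁻¹' A ∩ univ.pi fun _ => Ioi (0:ℝ) with hS
  let χ : (Fin (m + 1) → ℝ) → (Fin (m + 1) → ℝ) := fun z j => p (g' 0 (z j))
  have hsub : (Phi m g ⁻¹' A ∩ univ.pi fun _ => Ioi (0:ℝ)) ⊆
      ⋃ M : ℕ, χ '' (S ∩ univ.pi fun _ => Icc (0:ℝ) M) := by
    rintro w ⟨hwA, hw⟩
    have hw' : ∀ j, 0 < w j := fun j => hw j (mem_univ j)
    let z : Fin (m + 1) → ℝ := fun j => p' (g 0 (w j))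
    have hzn : ∀ j, 0 ≤ z j := fun j => D'.p_nonneg _ (D.g_mem (hw' j).le)
    have hgz : ∀ j, g' 0 (z j) = g 0 (w j) := fun j => D'.g_p _ (D.g_mem (hw' j).le)
    have hzp : ∀ j, 0 < z j := by
      intro j
      refine lt_of_le_of_ne (hzn j) fun h0 => ?_
      have h1 := hgz j
      rw [← h0, D'.zero] at h1
      have := D.strict (mem_Ici.2 le_rfl) (hw' j).le (hw' j)
      rw [D.zero] at this
      linarith
    obtain ⟨M, hM⟩ := exists_nat_ge (∑ j, z j)
    refine mem_iUnion.2 ⟨M, z, ⟨⟨?_, fun j _ => hzp j⟩, fun j _ => ⟨hzn j, ?_⟩⟩, ?_⟩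
    · have : Phi m g' z = Phi m g w := funext hgz
      rw [mem_preimage, this]; exact hwA
    · exact (Finset.single_le_sum (fun i _ => hzn i) (Finset.mem_univ j)).trans hM
    · funext j
      change p (g' 0 (z j)) = w j
      rw [hgz j, D.p_g (hw' j).le]
  refine measure_mono_null hsub (measure_iUnion_null fun M => ?_)
  have hc : 0 ≤ g' 1 0 / g 1 (p (g' 0 M)) := by
    refine div_nonneg (D'.chain.pos 1 (by omega) _ (mem_Ici.2 le_rfl)).le
      (D.chain.pos 1 (by omega) _ (D.p_nonneg _ (D'.g_mem (Nat.cast_nonneg M)))).le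
  have hlip : LipschitzOnWith (g' 1 0 / g 1 (p (g' 0 M))).toNNReal χ
      (S ∩ univ.pi fun _ => Icc (0:ℝ) M) := by
    apply LipschitzOnWith.of_dist_le_mul
    intro z hz w hw
    rw [Real.coe_toNNReal _ hc, dist_pi_le_iff (by positivity)]
    intro j
    rw [Real.dist_eq]
    refine (D.chi_lip D' (hz.2 j (mem_univ j)) (hw.2 j (mem_univ j))).trans ?_
    rw [← Real.dist_eq]
    exact mul_le_mul_of_nonneg_left (dist_le_pi_dist z w j) hc
  have h1 := hlip.hausdorffMeasure_image_le (d := (m + 1 : ℝ)) (by positivity)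
  have hvol : (Measure.hausdorffMeasure (m + 1 : ℝ) : Measure (Fin (m + 1) → ℝ)) = volume := by
    have := hausdorffMeasure_pi_real (ι := Fin (m + 1))
    rw [← this]; simp
  rw [hvol, measure_mono_null inter_subset_left h, mul_zero] at h1
  exact le_antisymm h1 bot_le

lemma CopData.ac {μ μ' : Measure ((Fin (m + 1) → ℝ) × ℝ)} {K K' : Kernel (Fin (m + 1) → ℝ) ℝ}
    (C : CopData m g p μ K) (C' : CopData m g' p' μ' K') :
    μ.map Prod.fst ≪ μ'.map Prod.fst := by
  refine Measure.AbsolutelyContinuous.mk fun A hA h => ?_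
  have h1 := measure_eq_zero_iff_ae_notMem.1 h
  have h2 := C'.ae_pull h1
  have h3 := C.D.ac C'.D hA (measure_eq_zero_iff_ae_notMem.2 h2)
  exact measure_eq_zero_iff_ae_notMem.2 (C.ae_push hA.compl (measure_eq_zero_iff_ae_notMem.1 h3))

lemma posMeas_sum_eq (c : ℝ) : posMeas m {z | ∑ i, z i = c} = 0 := by
  rw [posMeas_eq]
  apply Measure.absolutelyContinuous_of_le Measure.restrict_le_self
  rcases eq_empty_or_nonempty {z : Fin (m + 1) → ℝ | ∑ i, z i = c} with h | ⟨z0, h0⟩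
  · rw [h]; simp
  have h0' : ∑ i, z0 i = c := h0
  let L : (Fin (m + 1) → ℝ) →ₗ[ℝ] ℝ := ∑ i, LinearMap.proj i
  have hL : ∀ z, L z = ∑ i, z i := fun z => by simp [L]
  have hs : {z : Fin (m + 1) → ℝ | ∑ i, z i = c} = (AffineSubspace.mk' z0 (LinearMap.ker L) : Set _) := by
    ext z
    rw [SetLike.mem_coe, AffineSubspace.mem_mk', LinearMap.mem_ker, vsub_eq_sub, map_sub, hL, hL, h0',
      sub_eq_zero]
    rfl
  rw [hs]
  apply Measure.addHaar_affineSubspace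
  intro htop
  have : (fun i => z0 i + 1) ∈ AffineSubspace.mk' z0 (LinearMap.ker L) := by rw [htop]; trivial
  rw [AffineSubspace.mem_mk', LinearMap.mem_ker, vsub_eq_sub, map_sub, hL, hL, Finset.sum_add_distrib] at this
  simp at this
  linarith [(Nat.cast_nonneg m : (0:ℝ) ≤ m)]

lemma GenData.ae_cont (D : GenData m g p) (b : ℝ) :
    ∀ᵐ z ∂(posMeas m), ContinuousAt (g (m + 1)) (b + ∑ i, z i) := by
  have hc := (D.anti (m + 1) le_rfl).countable_not_continuousAt
  have : ∀ᵐ z ∂(posMeas m), ∀ d ∈ {x | ¬ ContinuousAt (g (m + 1)) x}, ∑ i, z i ≠ d - b := by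
    rw [ae_ball_iff hc]
    intro d _
    exact measure_eq_zero_iff_ae_notMem.1 (posMeas_sum_eq (d - b))
  filter_upwards [this] with z hz
  by_contra hn
  exact hz _ hn (by ring)

lemma CopData.ae_cont {μ : Measure ((Fin (m + 1) → ℝ) × ℝ)} {K : Kernel (Fin (m + 1) → ℝ) ℝ}
    (C : CopData m g p μ K) (b : ℝ) :
    ∀ᵐ s ∂(μ.map Prod.fst), ContinuousAt (g (m + 1)) (b + ∑ i, p (s i)) := by
  apply C.ae_push
  · have hc := (C.D.anti (m + 1) le_rfl).countable_not_continuousAt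
    have h : Measurable fun s : Fin (m + 1) → ℝ => b + ∑ j, p (s j) :=
      (Finset.measurable_sum _ fun i _ => C.pm.comp (measurable_pi_apply i)).const_add b
    have := h hc.measurableSet.compl
    convert this using 1
    ext s; simp
  · filter_upwards [C.D.ae_cont b, posMeas_ae] with z h hz
    rwa [C.sum_p_Phi hz]

lemma CopData.ae_Ioo {μ : Measure ((Fin (m + 1) → ℝ) × ℝ)} {K : Kernel (Fin (m + 1) → ℝ) ℝ}
    (C : CopData m g p μ K) :
    ∀ᵐ s ∂(μ.map Prod.fst), ∀ j, s j ∈ Ioo (0:ℝ) 1 := by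
  apply C.ae_push
  · have : {s : Fin (m + 1) → ℝ | ∀ j, s j ∈ Ioo (0:ℝ) 1} = univ.pi fun _ => Ioo (0:ℝ) 1 := by
      ext t; simp only [Set.mem_pi, mem_univ, true_imp_iff, mem_ofPred_eq]
    rw [this]; exact MeasurableSet.univ_pi fun _ => measurableSet_Ioo
  · filter_upwards [posMeas_ae] with z hz j
    refine ⟨(C.D.g_mem (hz j).le).1, ?_⟩
    have := C.D.strict (mem_Ici.2 le_rfl) (hz j).le (hz j)
    rwa [C.D.zero] at this

end ac
lemma weakConv_of_Iic {T : Set ℝ} (hT : ∀ a b : ℝ, a < b → ∃ t ∈ T, a < t ∧ t < b)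
    {μn : ℕ → Measure ℝ} {μ : Measure ℝ} [hn : ∀ n, IsProbabilityMeasure (μn n)]
    [h0 : IsProbabilityMeasure μ]
    (h : ∀ t ∈ T, Tendsto (fun n => μn n (Iic t)) atTop (𝓝 (μ (Iic t)))) : WeakConv μn μ := by
  let P : ℕ → ProbabilityMeasure ℝ := fun n => ⟨μn n, hn n⟩
  let Q : ProbabilityMeasure ℝ := ⟨μ, h0⟩
  suffices hPQ : Tendsto P atTop (𝓝 Q) from
    fun f => (ProbabilityMeasure.tendsto_iff_forall_integral_tendsto.1 hPQ) f
  have hpi : IsPiSystem {s : Set ℝ | ∃ a ∈ T, ∃ b ∈ T, s = Ioc a b} := by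
    rintro _ ⟨a, ha, b, hb, rfl⟩ _ ⟨c, hc, d, hd, rfl⟩ _
    refine ⟨max a c, ?_, min b d, ?_, Ioc_inter_Ioc⟩
    · rcases max_choice a c with h | h <;> rw [h] <;> assumption
    · rcases min_choice b d with h | h <;> rw [h] <;> assumption
  apply hpi.tendsto_probabilityMeasure_of_tendsto_of_mem
  · rintro _ ⟨a, ha, b, hb, rfl⟩; exact measurableSet_Ioc
  · intro u hu x hx
    obtain ⟨ε, hε, hb⟩ := Metric.isOpen_iff.1 hu x hx
    obtain ⟨a, ha, h1, h2⟩ := hT (x - ε) x (by linarith)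
    obtain ⟨b, hb', h3, h4⟩ := hT x (x + ε) (by linarith)
    refine ⟨Ioc a b, ⟨a, ha, b, hb', rfl⟩, Ioc_mem_nhds h2 h3, fun y hy => hb ?_⟩
    rw [Metric.mem_ball, Real.dist_eq, abs_lt]
    constructor <;> linarith [hy.1, hy.2]
  · rintro _ ⟨a, ha, b, hb, rfl⟩
    have hh : Tendsto (fun n => μn n (Ioc a b)) atTop (𝓝 (μ (Ioc a b))) := by
      rcases le_or_gt a b with hab | hab
      · have e : ∀ (ρ : Measure ℝ) [IsProbabilityMeasure ρ], ρ (Ioc a b) = ρ (Iic b) - ρ (Iic a) := by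
          intro ρ _
          rw [← measure_sdiff (Iic_subset_Iic.2 hab) measurableSet_Iic.nullMeasurableSet (measure_ne_top _ _)]
          congr 1
          ext y; simp [and_comm]
        simp only [e]
        exact ENNReal.Tendsto.sub (h b hb) (h a ha) (Or.inl (measure_ne_top _ _))
      · simp [Ioc_eq_empty hab.not_gt]
    exact (ENNReal.tendsto_toNNReal (measure_ne_top _ _)).comp hh

section conv
variable {m : ℕ} {g : ℕ → ℝ → ℝ} {p : ℝ → ℝ} {gn : ℕ → ℕ → ℝ → ℝ} {pn : ℕ → ℝ → ℝ}

lemma GenData.p_conv (D : GenData m g p) (Dn : ∀ n, GenData m (gn n) (pn n))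
    (hc : ∀ z, 0 ≤ z → Tendsto (fun n => gn n 0 z) atTop (𝓝 (g 0 z)))
    {u : ℝ} (hu : u ∈ Ioc (0:ℝ) 1) : Tendsto (fun n => pn n u) atTop (𝓝 (p u)) := by
  refine inv_conv (Fn := fun n => gn n 0) (F := g 0)
    (fun n => ((Dn n).anti 0 (Nat.zero_le _)).antitoneOn _) D.strict
    (fun z hz => hc z hz.le) (fun n => (Dn n).p_nonneg u hu) (D.p_nonneg u hu) ?_
  simp only [fun n => (Dn n).g_p u hu, D.g_p u hu]
  exact tendsto_const_nhds

lemma GenData.top_conv (D : GenData m g p) (Dn : ∀ n, GenData m (gn n) (pn n))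
    (hc : ∀ z, 0 ≤ z → Tendsto (fun n => gn n 0 z) atTop (𝓝 (g 0 z)))
    {wn : ℕ → ℝ} {w : ℝ} (hw : 0 < w) (hwn : Tendsto wn atTop (𝓝 w))
    (hcont : ContinuousAt (g (m + 1)) w) :
    Tendsto (fun n => gn n (m + 1) (wn n)) atTop (𝓝 (g (m + 1) w)) :=
  chain_conv (fun n => (Dn n).chain.mono) D.chain.mono (fun z hz => hc z hz.le) (m + 1) le_rfl wn w hw
    hwn hcont

lemma GenData.p_pos (D : GenData m g p) {u : ℝ} (hu : u ∈ Ioo (0:ℝ) 1) : 0 < p u := by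
  refine lt_of_le_of_ne (D.p_nonneg u ⟨hu.1, hu.2.le⟩) fun h => ?_
  have := D.g_p u ⟨hu.1, hu.2.le⟩
  rw [← h, D.zero] at this
  linarith [hu.2]

lemma GenData.kerF_conv (D : GenData m g p) (Dn : ∀ n, GenData m (gn n) (pn n))
    (hc : ∀ z, 0 ≤ z → Tendsto (fun n => gn n 0 z) atTop (𝓝 (g 0 z)))
    {s : Fin (m + 1) → ℝ} (hs : ∀ j, s j ∈ Ioo (0:ℝ) 1) {t : ℝ} (ht : t ∈ Ioc (0:ℝ) 1)
    (h1 : ContinuousAt (g (m + 1)) (p t + ∑ j, p (s j)))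
    (h2 : ContinuousAt (g (m + 1)) (∑ j, p (s j))) :
    Tendsto (fun n => kerF m (gn n) (pn n) t s) atTop (𝓝 (kerF m g p t s)) := by
  have hpos : 0 < ∑ j, p (s j) := Finset.sum_pos (fun j _ => D.p_pos (hs j)) Finset.univ_nonempty
  have hsum : Tendsto (fun n => ∑ j, pn n (s j)) atTop (𝓝 (∑ j, p (s j))) :=
    tendsto_finsetSum _ fun j _ => D.p_conv Dn hc ⟨(hs j).1, (hs j).2.le⟩
  refine (D.top_conv Dn hc ?_ ((D.p_conv Dn hc ht).add hsum) h1).div (D.top_conv Dn hc hpos hsum h2) ?_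
  · linarith [D.p_nonneg t ht]
  · exact (D.chain.pos _ le_rfl _ hpos.le).ne'

variable {μ : Measure ((Fin (m + 1) → ℝ) × ℝ)} {K : Kernel (Fin (m + 1) → ℝ) ℝ}
  {μn : ℕ → Measure ((Fin (m + 1) → ℝ) × ℝ)} {Kn : ℕ → Kernel (Fin (m + 1) → ℝ) ℝ}

lemma Iic_of_supp {ρ : Measure ℝ} [IsProbabilityMeasure ρ] (h : ρ (Icc 0 1)ᶜ = 0) :
    (∀ t < 0, ρ (Iic t) = 0) ∧ (∀ t, 1 ≤ t → ρ (Iic t) = 1) := by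
  constructor
  · intro t ht
    have hsub : Iic t ⊆ (Icc (0:ℝ) 1)ᶜ := fun y hy hy2 => by
      have : y ≤ t := hy
      linarith [hy2.1]
    exact measure_mono_null hsub h
  · intro t ht
    rw [← prob_compl_eq_zero_iff measurableSet_Iic]
    have hsub : (Iic t)ᶜ ⊆ (Icc (0:ℝ) 1)ᶜ := compl_subset_compl.2 fun y hy => hy.2.trans ht
    exact measure_mono_null hsub h

lemma CopData.ae_weak (C : CopData m g p μ K) (Cn : ∀ n, CopData m (gn n) (pn n) (μn n) (Kn n))
    (hc : ∀ z, 0 ≤ z → Tendsto (fun n => gn n 0 z) atTop (𝓝 (g 0 z))) :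
    ∀ᵐ s ∂(μ.map Prod.fst), WeakConv (fun n => Kn n s) (K s) := by
  have hker : ∀ᵐ s ∂(μ.map Prod.fst), ∀ q : ℚ, (q:ℝ) ∈ Ioc (0:ℝ) 1 →
      K s (Iic (q:ℝ)) = ENNReal.ofReal (kerF m g p q s) := by
    refine ae_all_iff.2 fun q => ?_
    by_cases hq : (q:ℝ) ∈ Ioc (0:ℝ) 1
    · filter_upwards [C.kernel hq] with s hs _ using hs
    · exact Eventually.of_forall fun s h => absurd h hq
  have hkern : ∀ᵐ s ∂(μ.map Prod.fst), ∀ n, ∀ q : ℚ, (q:ℝ) ∈ Ioc (0:ℝ) 1 →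
      Kn n s (Iic (q:ℝ)) = ENNReal.ofReal (kerF m (gn n) (pn n) q s) := by
    refine ae_all_iff.2 fun n => ae_all_iff.2 fun q => ?_
    by_cases hq : (q:ℝ) ∈ Ioc (0:ℝ) 1
    · filter_upwards [(C.ac (Cn n)).ae_le ((Cn n).kernel hq)] with s hs _ using hs
    · exact Eventually.of_forall fun s h => absurd h hq
  have hsupn : ∀ᵐ s ∂(μ.map Prod.fst), ∀ n, Kn n s (Icc 0 1)ᶜ = 0 :=
    ae_all_iff.2 fun n => (C.ac (Cn n)).ae_le (Cn n).ker_neg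
  have hcont : ∀ᵐ s ∂(μ.map Prod.fst), ∀ q : ℚ,
      ContinuousAt (g (m + 1)) (p q + ∑ i, p (s i)) :=
    ae_all_iff.2 fun q => C.ae_cont _
  filter_upwards [hker, hkern, hsupn, hcont, C.ae_cont 0, C.ker_neg, C.ae_Ioo] with
    s h1 h2 h3 h4 h5 h6 h7
  have := C.markov
  have := fun n => (Cn n).markov
  rw [zero_add] at h5
  refine weakConv_of_Iic (T := {t | ∃ q : ℚ, t = q ∧ q ≠ 0}) ?_ ?_
  · intro a b hab
    obtain ⟨q, h1, h2⟩ := exists_rat_btwn hab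
    by_cases hq : q = 0
    · subst hq
      obtain ⟨r, h3, h4⟩ := exists_rat_btwn h1
      refine ⟨r, ⟨r, rfl, ?_⟩, h3, h4.trans h2⟩
      rintro rfl
      exact absurd h4 (lt_irrefl _)
    · exact ⟨q, ⟨q, rfl, hq⟩, h1, h2⟩
  · rintro _ ⟨q, rfl, hq⟩
    rcases lt_trichotomy (q:ℝ) 0 with h | h | h
    · simp only [(Iic_of_supp h6).1 q h, fun n => (Iic_of_supp (h3 n)).1 q h]
      exact tendsto_const_nhds
    · exact absurd (by exact_mod_cast h) hq
    · rcases le_or_gt (q:ℝ) 1 with h' | h'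
      · simp only [h1 q ⟨h, h'⟩, fun n => h2 n q ⟨h, h'⟩]
        exact (ENNReal.continuous_ofReal.tendsto _).comp
          (C.D.kerF_conv (fun n => (Cn n).D) hc h7 ⟨h, h'⟩ (h4 q) h5)
      · simp only [(Iic_of_supp h6).2 q h'.le, fun n => (Iic_of_supp (h3 n)).2 q h'.le]
        exact tendsto_const_nhds

lemma CopData.weak (C : CopData m g p μ K) (Cn : ∀ n, CopData m (gn n) (pn n) (μn n) (Kn n))
    (hc : ∀ z, 0 ≤ z → Tendsto (fun n => gn n 0 z) atTop (𝓝 (g 0 z))) :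
    ∃ Λ : Set (Fin (m + 1) → ℝ), MeasurableSet Λ ∧ μ.map Prod.fst Λ = 1 ∧
      ∀ s ∈ Λ, WeakConv (fun n => Kn n s) (K s) := by
  have := C.prob
  have : IsProbabilityMeasure (μ.map (Prod.fst : _ → (Fin (m + 1) → ℝ))) :=
    Measure.isProbabilityMeasure_map measurable_fst.aemeasurable
  obtain ⟨B, hB1, hB2, hB3⟩ := exists_measurable_superset_of_null (ae_iff.1 (C.ae_weak Cn hc))
  refine ⟨Bᶜ, hB2.compl, (prob_compl_eq_one_iff hB2).2 hB3, fun s hs => ?_⟩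
  by_contra hn
  exact hs (hB1 hn)

end conv
lemma scheffe {α : Type*} [MeasurableSpace α] {ρ : Measure α} {f : α → ℝ} {fn : ℕ → α → ℝ}
    (hf : Integrable f ρ) (hfn : ∀ n, Integrable (fn n) ρ)
    (h0 : ∀ᵐ x ∂ρ, 0 ≤ f x) (h0n : ∀ n, ∀ᵐ x ∂ρ, 0 ≤ fn n x)
    (hint : ∀ n, ∫ x, fn n x ∂ρ = ∫ x, f x ∂ρ)
    (hconv : ∀ᵐ x ∂ρ, Tendsto (fun n => fn n x) atTop (𝓝 (f x))) :
    Tendsto (fun n => ∫ x, |fn n x - f x| ∂ρ) atTop (𝓝 0) := by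
  have hsub : ∀ n, Integrable (fun x => f x - fn n x) ρ := fun n => hf.sub (hfn n)
  have hmax : ∀ n, Integrable (fun x => max (f x - fn n x) 0) ρ := fun n => (hsub n).pos_part
  have e : ∀ n, ∫ x, |fn n x - f x| ∂ρ = 2 * ∫ x, max (f x - fn n x) 0 ∂ρ := by
    intro n
    have h1 : ∀ x, |fn n x - f x| = 2 * max (f x - fn n x) 0 - (f x - fn n x) := by
      intro x
      rcases le_total (fn n x) (f x) with h | h
      · rw [max_eq_left (by linarith), abs_of_nonpos (by linarith)]; ring
      · rw [max_eq_right (by linarith), abs_of_nonneg (by linarith)]; ring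
    simp only [h1]
    rw [integral_sub ((hmax n).const_mul 2) (hsub n), integral_sub hf (hfn n), hint n, integral_const_mul]
    ring
  simp only [e]
  have hl : Tendsto (fun n => ∫ x, max (f x - fn n x) 0 ∂ρ) atTop (𝓝 (∫ _, (0:ℝ) ∂ρ)) := by
    refine tendsto_integral_of_dominated_convergence f (fun n => (hmax n).aestronglyMeasurable) hf ?_ ?_
    · intro n
      filter_upwards [h0, h0n n] with x h1 h2
      rw [Real.norm_of_nonneg (le_max_right _ _)]
      exact max_le (by linarith) h1
    · filter_upwards [hconv] with x hx
      have : Tendsto (fun n => max (f x - fn n x) 0) atTop (𝓝 (max (f x - f x) 0)) :=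
        (tendsto_const_nhds.sub hx).max tendsto_const_nhds
      simpa using this
  rw [integral_zero] at hl
  simpa using hl.const_mul 2

lemma l1_bound {α : Type*} [MeasurableSpace α] {ρ : Measure α} {a b a' b' : α → ℝ} {y : ℝ}
    (hy : 0 ≤ y) (ha : Integrable a ρ) (hb : Integrable b ρ) (ha' : Integrable a' ρ)
    (hb' : Integrable b' ρ) :
    dist (∫ z, |a z - y * b z| ∂ρ) (∫ z, |a' z - y * b' z| ∂ρ)
      ≤ ∫ z, |a z - a' z| ∂ρ + y * ∫ z, |b z - b' z| ∂ρ := by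
  have i1 : Integrable (fun z => |a z - y * b z|) ρ := (ha.sub (hb.const_mul y)).abs
  have i2 : Integrable (fun z => |a' z - y * b' z|) ρ := (ha'.sub (hb'.const_mul y)).abs
  have i3 : Integrable (fun z => |a z - a' z|) ρ := (ha.sub ha').abs
  have i4 : Integrable (fun z => y * |b z - b' z|) ρ := (hb.sub hb').abs.const_mul y
  rw [Real.dist_eq, ← integral_sub i1 i2, ← integral_const_mul, ← integral_add i3 i4]
  refine abs_integral_le_integral_abs.trans (integral_mono (i1.sub i2).abs (i3.add i4) fun z => ?_)
  change |(|a z - y * b z| - |a' z - y * b' z|)| ≤ |a z - a' z| + y * |b z - b' z|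
  refine (abs_abs_sub_abs_le _ _).trans ?_
  have e : a z - y * b z - (a' z - y * b' z) = (a z - a' z) + -(y * (b z - b' z)) := by ring
  rw [e]
  refine (abs_add_le _ _).trans ?_
  rw [abs_neg, abs_mul, abs_of_nonneg hy]

section zeta
variable {m : ℕ} {g : ℕ → ℝ → ℝ} {p : ℝ → ℝ} {gn : ℕ → ℕ → ℝ → ℝ} {pn : ℕ → ℝ → ℝ}
  {μ : Measure ((Fin (m + 1) → ℝ) × ℝ)} {K : Kernel (Fin (m + 1) → ℝ) ℝ}
  {μn : ℕ → Measure ((Fin (m + 1) → ℝ) × ℝ)} {Kn : ℕ → Kernel (Fin (m + 1) → ℝ) ℝ}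

lemma GenData.ae_top_nonneg (D : GenData m g p) {w : ℝ} (hw : 0 ≤ w) :
    ∀ᵐ z ∂(posMeas m), 0 ≤ g (m + 1) (w + ∑ i, z i) := by
  filter_upwards [posMeas_ae] with z hz
  exact (D.chain.pos _ le_rfl _ (add_nonneg hw (Finset.sum_nonneg fun i _ => (hz i).le))).le

lemma GenData.meas_shift (D : GenData m g p) (w : ℝ) :
    Measurable fun z : Fin (m + 1) → ℝ => g (m + 1) (w + ∑ i, z i) :=
  D.meas_top.comp ((Finset.measurable_sum _ fun i _ => measurable_pi_apply i).const_add w)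

lemma GenData.lint (D : GenData m g p) {w : ℝ} (hw : 0 ≤ w) :
    ∫⁻ z, ENNReal.ofReal (g (m + 1) (w + ∑ i, z i)) ∂(posMeas m) = ENNReal.ofReal (g 0 w) := by
  have := D.chain.int_pi D.anti (m + 1) 0 (by omega) w hw (fun _ => 0) (fun _ => le_rfl)
  rw [Nat.zero_add] at this
  simpa [posMeas] using this

lemma GenData.integrable (D : GenData m g p) {w : ℝ} (hw : 0 ≤ w) :
    Integrable (fun z : Fin (m + 1) → ℝ => g (m + 1) (w + ∑ i, z i)) (posMeas m) := by
  rw [← lintegral_ofReal_ne_top_iff_integrable (D.meas_shift w).aestronglyMeasurable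
    (D.ae_top_nonneg hw), D.lint hw]
  exact ENNReal.ofReal_ne_top

lemma GenData.integral (D : GenData m g p) {w : ℝ} (hw : 0 ≤ w) :
    ∫ z, g (m + 1) (w + ∑ i, z i) ∂(posMeas m) = g 0 w := by
  rw [integral_eq_lintegral_of_nonneg_ae (D.ae_top_nonneg hw) (D.meas_shift w).aestronglyMeasurable,
    D.lint hw, ENNReal.toReal_ofReal (D.g_mem hw).1.le]

lemma CopData.inner (C : CopData m g p μ K) {y : ℝ} (hy : y ∈ Ioc (0:ℝ) 1) :
    ∫ s, |(K s (Iic y)).toReal - y| ∂(μ.map Prod.fst)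
      = ∫ z, |g (m + 1) (p y + ∑ i, z i) - y * g (m + 1) (0 + ∑ i, z i)| ∂(posMeas m) := by
  have h1 : ∫ s, |(K s (Iic y)).toReal - y| ∂(μ.map Prod.fst)
      = ∫ s, |(ENNReal.ofReal (kerF m g p y s)).toReal - y| ∂(μ.map Prod.fst) := by
    apply integral_congr_ae
    filter_upwards [C.kernel hy] with s hs
    rw [hs]
  have hm : Measurable fun s => |(ENNReal.ofReal (kerF m g p y s)).toReal - y| := by
    have := (C.meas_kerF y).ennreal_ofReal.ennreal_toReal.sub_const y
    exact measurable_norm.comp this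
  rw [h1, C.ident_one, integral_map C.D.meas_Phi.aemeasurable hm.aestronglyMeasurable,
    integral_withDensity_eq_integral_toReal_smul (C.D.meas_dens 0)
      (Eventually.of_forall fun z => ENNReal.ofReal_lt_top)]
  apply integral_congr_ae
  filter_upwards [posMeas_ae] with z hz
  have hS : 0 ≤ ∑ i, z i := Finset.sum_nonneg fun i _ => (hz i).le
  have hpos : 0 < g (m + 1) (∑ i, z i) := C.D.chain.pos _ le_rfl _ hS
  have hpos2 : 0 < g (m + 1) (p y + ∑ i, z i) :=
    C.D.chain.pos _ le_rfl _ (add_nonneg (C.D.p_nonneg y hy) hS)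
  simp only [dens, kerF, C.sum_p_Phi hz, zero_add, smul_eq_mul]
  rw [ENNReal.toReal_ofReal hpos.le, ENNReal.toReal_ofReal (by positivity)]
  conv_lhs => rw [← abs_of_pos hpos, ← abs_mul, abs_of_pos hpos]
  congr 1
  field_simp

lemma CopData.inner_conv (C : CopData m g p μ K) (Cn : ∀ n, CopData m (gn n) (pn n) (μn n) (Kn n))
    (hc : ∀ z, 0 ≤ z → Tendsto (fun n => gn n 0 z) atTop (𝓝 (g 0 z))) {y : ℝ}
    (hy : y ∈ Ioc (0:ℝ) 1) :
    Tendsto (fun n => ∫ s, |(Kn n s (Iic y)).toReal - y| ∂((μn n).map Prod.fst)) atTop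
      (𝓝 (∫ s, |(K s (Iic y)).toReal - y| ∂(μ.map Prod.fst))) := by
  have hp := C.D.p_nonneg y hy
  have hpn := fun n => (Cn n).D.p_nonneg y hy
  have key : ∀ (wn : ℕ → ℝ) (w : ℝ), (∀ n, 0 ≤ wn n) → 0 ≤ w → Tendsto wn atTop (𝓝 w) →
      (∀ n, gn n 0 (wn n) = g 0 w) →
      Tendsto (fun n => ∫ z, |gn n (m + 1) (wn n + ∑ i, z i) - g (m + 1) (w + ∑ i, z i)| ∂(posMeas m))
        atTop (𝓝 0) := by
    intro wn w hwn hw hlim he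
    refine scheffe (f := fun z : Fin (m + 1) → ℝ => g (m + 1) (w + ∑ i, z i))
      (fn := fun n z => gn n (m + 1) (wn n + ∑ i, z i))
      (C.D.integrable hw) (fun n => (Cn n).D.integrable (hwn n)) (C.D.ae_top_nonneg hw)
      (fun n => (Cn n).D.ae_top_nonneg (hwn n)) ?_ ?_
    · intro n
      rw [C.D.integral hw, (Cn n).D.integral (hwn n), he n]
    · filter_upwards [C.D.ae_cont w, posMeas_ae] with z hz hz0
      have : 0 < ∑ i, z i := Finset.sum_pos (fun i _ => hz0 i) Finset.univ_nonempty
      exact C.D.top_conv (fun n => (Cn n).D) hc (by linarith) (hlim.add_const _) hz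
  have ha := key (fun n => pn n y) (p y) hpn hp (C.D.p_conv (fun n => (Cn n).D) hc hy)
    (fun n => by rw [(Cn n).D.g_p y hy, C.D.g_p y hy])
  have hb := key (fun _ => 0) 0 (fun _ => le_rfl) le_rfl tendsto_const_nhds
    (fun n => by rw [(Cn n).D.zero, C.D.zero])
  rw [C.inner hy]
  simp only [fun n => (Cn n).inner hy]
  rw [tendsto_iff_dist_tendsto_zero]
  have hab := ha.add (hb.const_mul y)
  rw [mul_zero, add_zero] at hab
  exact squeeze_zero (fun n => dist_nonneg) (fun n => l1_bound hy.1.le ((Cn n).D.integrable (hpn n))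
    ((Cn n).D.integrable (le_refl (0:ℝ))) (C.D.integrable hp) (C.D.integrable (le_refl (0:ℝ)))) hab

lemma CopData.meas_outer (C : CopData m g p μ K) :
    StronglyMeasurable fun y : ℝ => ∫ s, |(K s (Iic y)).toReal - y| ∂(μ.map Prod.fst) := by
  have := C.prob
  have := C.markov
  have : IsProbabilityMeasure (μ.map (Prod.fst : _ → (Fin (m + 1) → ℝ))) :=
    Measure.isProbabilityMeasure_map measurable_fst.aemeasurable
  have hset : MeasurableSet {q : (ℝ × (Fin (m + 1) → ℝ)) × ℝ | q.2 ≤ q.1.1} :=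
    measurableSet_le measurable_snd (measurable_fst.comp measurable_fst)
  have h1 : Measurable fun q : ℝ × (Fin (m + 1) → ℝ) => K q.2 (Iic q.1) :=
    Kernel.measurable_kernel_prodMk_left (κ := K.comap Prod.snd measurable_snd) hset
  have h2 : Measurable fun q : ℝ × (Fin (m + 1) → ℝ) => |(K q.2 (Iic q.1)).toReal - q.1| :=
    measurable_norm.comp (h1.ennreal_toReal.sub measurable_fst)
  exact h2.stronglyMeasurable.integral_prod_right

lemma CopData.outer_bound (C : CopData m g p μ K) {y : ℝ} (hy : y ∈ Icc (0:ℝ) 1) :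
    ‖∫ s, |(K s (Iic y)).toReal - y| ∂(μ.map Prod.fst)‖ ≤ 1 := by
  have := C.prob
  have := C.markov
  have : IsProbabilityMeasure (μ.map (Prod.fst : _ → (Fin (m + 1) → ℝ))) :=
    Measure.isProbabilityMeasure_map measurable_fst.aemeasurable
  refine (norm_integral_le_of_norm_le_const (C := 1) (Eventually.of_forall fun s => ?_)).trans (by simp)
  rw [Real.norm_eq_abs, abs_abs, abs_le]
  have h1 : (K s (Iic y)).toReal ≤ 1 := by
    have := ENNReal.toReal_mono ENNReal.one_ne_top (prob_le_one (μ := K s) (s := Iic y))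
    simpa using this
  have h2 : 0 ≤ (K s (Iic y)).toReal := ENNReal.toReal_nonneg
  constructor <;> linarith [hy.1, hy.2]

lemma CopData.zeta_conv (C : CopData m g p μ K) (Cn : ∀ n, CopData m (gn n) (pn n) (μn n) (Kn n))
    (hc : ∀ z, 0 ≤ z → Tendsto (fun n => gn n 0 z) atTop (𝓝 (g 0 z))) :
    Tendsto (fun n => |zeta1 ((μn n).map Prod.fst) (Kn n) - zeta1 (μ.map Prod.fst) K|)
      atTop (𝓝 0) := by
  have h : Tendsto (fun n => zeta1 ((μn n).map Prod.fst) (Kn n)) atTop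
      (𝓝 (zeta1 (μ.map Prod.fst) K)) := by
    unfold zeta1
    refine Tendsto.const_mul 3 ?_
    refine tendsto_integral_of_dominated_convergence (fun _ => 1)
      (fun n => (Cn n).meas_outer.aestronglyMeasurable) (integrable_const _) ?_ ?_
    · intro n
      filter_upwards [ae_restrict_mem measurableSet_Icc] with y hy using (Cn n).outer_bound hy
    · have h0 : ∀ᵐ y ∂(volume.restrict (Icc (0:ℝ) 1)), y ≠ 0 :=
        ae_restrict_of_ae (Measure.ae_ne volume (0:ℝ))
      filter_upwards [ae_restrict_mem measurableSet_Icc, h0] with y hy hy0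
      exact C.inner_conv Cn hc ⟨lt_of_le_of_ne hy.1 (Ne.symm hy0), hy.2⟩
  rw [tendsto_iff_dist_tendsto_zero] at h
  simpa only [Real.dist_eq] using h

end zeta
/-- **Corollary 6.6.** Let `C, C₁, C₂, …` be strict `d`-dimensional Archimedean copulas
(here `d = ℓ + m + 2`, so that `ℓ ∈ {1,…,d-2}` and the conditional copulas are
`(m+2)`-dimensional), and fix `x ∈ (0,1)^ℓ`. If `(C_n)` converges uniformly to `C`
then the conditional copulas `(C_nˣ)` (with measures `μxₙ` on `ℝ^{m+1} × ℝ` and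
`(d-ℓ-1)`-Markov kernels `Kxₙ`) converge `(d-ℓ-1)`-weakly conditional to `Cˣ`,
and `|ζ₁ˣ(C_n) − ζ₁ˣ(C)| → 0` where `ζ₁ˣ(C) = ζ₁^{d-ℓ}(Cˣ)`. -/
theorem conditional_zeta1_convergence
    (l m : ℕ) (hl : 1 ≤ l)
    (ψ φ : ℝ → ℝ) (hgen : IsStrictGenerator (l + m + 2) ψ φ)
    (ψn φn : ℕ → ℝ → ℝ) (hgenn : ∀ n, IsStrictGenerator (l + m + 2) (ψn n) (φn n))
    (hconv : TendstoUniformlyOn (fun n => archCopF (ψn n) (φn n))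
      (archCopF ψ φ (k := l + m + 2)) atTop (unitCube (l + m + 2)))
    (x : Fin l → ℝ) (hx : ∀ i, x i ∈ Ioo (0:ℝ) 1)
    (μx : Measure ((Fin (m + 1) → ℝ) × ℝ)) (hμxp : IsProbabilityMeasure μx)
    (hμxc : μx ((unitCube (m + 1)) ×ˢ Icc (0:ℝ) 1) = 1)
    (hμx : ∀ (s : Fin (m + 1) → ℝ) (t : ℝ), (∀ j, s j ∈ Ioc (0:ℝ) 1) → t ∈ Ioc (0:ℝ) 1 →
      μx (lowerBox s ×ˢ Iic t) = ENNReal.ofReal (condCop ψ φ x (Fin.snoc s t)))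
    (μxn : ℕ → Measure ((Fin (m + 1) → ℝ) × ℝ)) (hμxnp : ∀ n, IsProbabilityMeasure (μxn n))
    (hμxnc : ∀ n, μxn n ((unitCube (m + 1)) ×ˢ Icc (0:ℝ) 1) = 1)
    (hμxn : ∀ n, ∀ (s : Fin (m + 1) → ℝ) (t : ℝ),
      (∀ j, s j ∈ Ioc (0:ℝ) 1) → t ∈ Ioc (0:ℝ) 1 →
      μxn n (lowerBox s ×ˢ Iic t) = ENNReal.ofReal (condCop (ψn n) (φn n) x (Fin.snoc s t)))
    (Kx : Kernel (Fin (m + 1) → ℝ) ℝ) (hKx : IsMarkovKernel Kx)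
    (hdx : IsDisintegration μx Kx)
    (Kxn : ℕ → Kernel (Fin (m + 1) → ℝ) ℝ) (hKxn : ∀ n, IsMarkovKernel (Kxn n))
    (hdxn : ∀ n, IsDisintegration (μxn n) (Kxn n)) :
    (∃ Λ : Set (Fin (m + 1) → ℝ), MeasurableSet Λ ∧ μx.map Prod.fst Λ = 1 ∧
      ∀ s ∈ Λ, WeakConv (fun n => Kxn n s) (Kx s)) ∧
    Tendsto (fun n => |zeta1 ((μxn n).map Prod.fst) (Kxn n) - zeta1 (μx.map Prod.fst) Kx|)
      atTop (nhds 0) := by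
  obtain ⟨g, p, gn, pn, D, Dn, hc, hf, hfn⟩ := reduction hl hgen hgenn hconv hx
  obtain ⟨p', hpm, D', hpp⟩ := D.exists_meas
  choose pn' hpmn Dn' hppn using fun n => (Dn n).exists_meas
  have C : CopData m g p' μx Kx := by
    refine ⟨D', hpm, hμxp, hμxc, fun s t hs ht => ?_, hKx, hdx⟩
    rw [hμx s t hs ht, hf s t hs ht, hpp t ht, Finset.sum_congr rfl fun j _ => hpp (s j) (hs j)]
  have Cn : ∀ n, CopData m (gn n) (pn' n) (μxn n) (Kxn n) := by
    intro n
    refine ⟨Dn' n, hpmn n, hμxnp n, hμxnc n, fun s t hs ht => ?_, hKxn n, hdxn n⟩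
    rw [hμxn n s t hs ht, hfn n s t hs ht, hppn n t ht,
      Finset.sum_congr rfl fun j _ => hppn n (s j) (hs j)]
  exact ⟨C.weak Cn hc, C.zeta_conv Cn hc⟩
end
end

section
/- Let C, C₁, C₂, … be d-dimensional copulas with (d−1)-Markov kernels K_C, K_{C₁}, K_{C₂}, …, respectively. If (C_n) converges (d−1)-weakly conditional to C and the marginal measures μ_{C_n^{1:d−1}} converge in total variation to μ_{C^{1:d−1}}, then lim_{n→∞} ζ₁^d(C_n) = ζ₁^d(C). -/
open MeasureTheory ProbabilityTheory Set Filter Topology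
open scoped ENNReal

noncomputable section

lemma tv_integral_bound {α : Type*} [MeasurableSpace α] (P Q : Measure α)
    [IsProbabilityMeasure P] [IsProbabilityMeasure Q] (f : α → ℝ) (hf : Measurable f)
    (h0 : ∀ a, 0 ≤ f a) (h1 : ∀ a, f a ≤ 1) :
    |∫ a, f a ∂P - ∫ a, f a ∂Q| ≤
      ⨆ A : {A : Set α // MeasurableSet A}, |(P A.1).toReal - (Q A.1).toReal| := by
  set S := ⨆ A : {A : Set α // MeasurableSet A}, |(P A.1).toReal - (Q A.1).toReal| with hS
  have hbdd : BddAbove (range fun A : {A : Set α // MeasurableSet A} =>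
      |(P A.1).toReal - (Q A.1).toReal|) := by
    refine ⟨1, ?_⟩
    rintro _ ⟨A, rfl⟩
    have a1 : (P A.1).toReal ≤ 1 := measureReal_le_one
    have a2 : (Q A.1).toReal ≤ 1 := measureReal_le_one
    have a3 : 0 ≤ (P A.1).toReal := ENNReal.toReal_nonneg
    have a4 : 0 ≤ (Q A.1).toReal := ENNReal.toReal_nonneg
    exact abs_le.2 ⟨by linarith, by linarith⟩
  have key : ∀ ρ : Measure α, IsProbabilityMeasure ρ →
      ∫ a, f a ∂ρ = ∫ t in Ioc (0:ℝ) 1, ρ.real {a | t ≤ f a} := by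
    intro ρ hR
    refine Integrable.integral_eq_integral_Ioc_meas_le ?_ (ae_of_all _ h0) (ae_of_all _ h1)
    refine Integrable.of_bound hf.aestronglyMeasurable 1 (ae_of_all _ fun a => ?_)
    rw [Real.norm_eq_abs, abs_of_nonneg (h0 a)]
    exact h1 a
  have hint : ∀ ρ : Measure α, IsProbabilityMeasure ρ →
      IntegrableOn (fun t : ℝ => ρ.real {a | t ≤ f a}) (Ioc (0:ℝ) 1) := by
    intro ρ hR
    have hanti : Antitone (fun t : ℝ => ρ.real {a | t ≤ f a}) := by
      intro x y hxy
      exact measureReal_mono (fun a (ha : y ≤ f a) => le_trans hxy ha)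
    refine Integrable.of_bound hanti.measurable.aestronglyMeasurable 1 (ae_of_all _ fun a => ?_)
    rw [Real.norm_eq_abs, abs_of_nonneg measureReal_nonneg]
    exact measureReal_le_one
  rw [key P inferInstance, key Q inferInstance,
    ← integral_sub (hint P inferInstance) (hint Q inferInstance)]
  have := norm_setIntegral_le_of_norm_le_const (μ := volume) (s := Ioc (0:ℝ) 1) (C := S)
    (f := fun t => P.real {a | t ≤ f a} - Q.real {a | t ≤ f a}) (by simp)
    (fun t _ => le_ciSup hbdd ⟨{a | t ≤ f a}, measurableSet_le measurable_const hf⟩)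
  simpa using this

lemma weakConv_Iic (P : ℕ → Measure ℝ) (Q : Measure ℝ) (hP : ∀ n, IsProbabilityMeasure (P n))
    (hQ : IsProbabilityMeasure Q) (h : WeakConv P Q) (y : ℝ) (hy : Q {y} = 0) :
    Tendsto (fun n => (P n (Iic y)).toReal) atTop (nhds (Q (Iic y)).toReal) := by
  let P' : ℕ → ProbabilityMeasure ℝ := fun n => ⟨P n, hP n⟩
  let Q' : ProbabilityMeasure ℝ := ⟨Q, hQ⟩
  have hT : Tendsto P' atTop (nhds Q') :=
    ProbabilityMeasure.tendsto_iff_forall_integral_tendsto.2 h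
  have := ProbabilityMeasure.tendsto_measure_of_null_frontier_of_tendsto' hT (E := Iic y)
    (by rw [frontier_Iic]; exact hy)
  exact (ENNReal.tendsto_toReal (measure_ne_top Q _)).comp this

lemma measurable_kernel_Iic {α : Type*} [MeasurableSpace α] (K : Kernel α ℝ)
    [IsMarkovKernel K] : Measurable (fun p : ℝ × α => |(K p.2 (Iic p.1)).toReal - p.1|) := by
  have h : Measurable (fun p : ℝ × α => K p.2 (Iic p.1)) := by
    have hs : MeasurableSet {q : (ℝ × α) × ℝ | q.2 ≤ q.1.1} :=
      measurableSet_le measurable_snd (measurable_fst.comp measurable_fst)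
    exact Kernel.measurable_kernel_prodMk_left (κ := K.comap Prod.snd measurable_snd) hs
  exact _root_.continuous_abs.measurable.comp (h.ennreal_toReal.sub measurable_fst)

lemma kernel_bound {α : Type*} [MeasurableSpace α] (K : Kernel α ℝ)
    [IsMarkovKernel K] (s : α) {y : ℝ} (hy : y ∈ Icc (0:ℝ) 1) :
    |(K s (Iic y)).toReal - y| ≤ 1 := by
  have a1 : (K s (Iic y)).toReal ≤ 1 := measureReal_le_one
  have a3 : 0 ≤ (K s (Iic y)).toReal := ENNReal.toReal_nonneg
  exact abs_le.2 ⟨by linarith [hy.2], by linarith [hy.1]⟩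

/-- **Lemma B.2.** Let `C, C₁, C₂, …` be `d`-dimensional copulas (modeled by their
measures on `ℝ^{d-1} × ℝ`, with uniform `[0,1]` marginals, here `m = d − 1`) with
`(d-1)`-Markov kernels `K, K₁, K₂, …`. If `(C_n)` converges `(d-1)`-weakly conditional
to `C` and the marginal measures `μ_{C_n^{1:d-1}}` converge in total variation to
`μ_{C^{1:d-1}}`, then `ζ₁^d(C_n) → ζ₁^d(C)`. -/
theorem zeta1_convergence
    (m : ℕ) (hm : 1 ≤ m)
    (μ : Measure ((Fin m → ℝ) × ℝ)) (hμp : IsProbabilityMeasure μ)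
    (hmargA : ∀ i : Fin m, μ.map (fun p => p.1 i) = volume.restrict (Icc (0:ℝ) 1))
    (hmargB : μ.map Prod.snd = volume.restrict (Icc (0:ℝ) 1))
    (μn : ℕ → Measure ((Fin m → ℝ) × ℝ)) (hμnp : ∀ n, IsProbabilityMeasure (μn n))
    (hmargnA : ∀ n, ∀ i : Fin m, (μn n).map (fun p => p.1 i) = volume.restrict (Icc (0:ℝ) 1))
    (hmargnB : ∀ n, (μn n).map Prod.snd = volume.restrict (Icc (0:ℝ) 1))
    (K : Kernel (Fin m → ℝ) ℝ) (hK : IsMarkovKernel K) (hdis : IsDisintegration μ K)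
    (Kn : ℕ → Kernel (Fin m → ℝ) ℝ) (hKn : ∀ n, IsMarkovKernel (Kn n))
    (hdisn : ∀ n, IsDisintegration (μn n) (Kn n))
    (hwc : ∃ Λ : Set (Fin m → ℝ), MeasurableSet Λ ∧ μ.map Prod.fst Λ = 1 ∧
      ∀ s ∈ Λ, WeakConv (fun n => Kn n s) (K s))
    (htv : Tendsto (fun n => ⨆ A : {A : Set (Fin m → ℝ) // MeasurableSet A},
        |(((μn n).map Prod.fst) A.1).toReal - ((μ.map Prod.fst) A.1).toReal|)
      atTop (nhds 0)) :
    Tendsto (fun n => zeta1 ((μn n).map Prod.fst) (Kn n)) atTop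
      (nhds (zeta1 (μ.map Prod.fst) K)) := by
  obtain ⟨Λ, hΛm, hΛ1, hΛ⟩ := hwc
  have hν : IsProbabilityMeasure (μ.map Prod.fst) :=
    Measure.isProbabilityMeasure_map measurable_fst.aemeasurable
  have hνn : ∀ n, IsProbabilityMeasure ((μn n).map Prod.fst) := fun n =>
    Measure.isProbabilityMeasure_map measurable_fst.aemeasurable
  have hΛae : ∀ᵐ s ∂(μ.map Prod.fst), s ∈ Λ := (prob_compl_eq_zero_iff hΛm).2 hΛ1
  have hatom : ∀ y : ℝ, ∀ᵐ s ∂(μ.map Prod.fst), K s {y} = 0 := by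
    intro y
    have h1 := hdis (Prod.snd ⁻¹' {y}) (measurable_snd (measurableSet_singleton y))
    have h2 : μ (Prod.snd ⁻¹' {y}) = 0 := by
      rw [← Measure.map_apply measurable_snd (measurableSet_singleton y), hmargB]
      simp
    rw [h2] at h1
    exact (lintegral_eq_zero_iff (K.measurable_coe (measurableSet_singleton y))).1 h1.symm
  have hmeas : ∀ (L : Kernel (Fin m → ℝ) ℝ), IsMarkovKernel L → ∀ y : ℝ,
      Measurable (fun s => |(L s (Iic y)).toReal - y|) := fun L hL y =>
    (measurable_kernel_Iic L).comp measurable_prodMk_left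
  have hpt : ∀ y ∈ Icc (0:ℝ) 1,
      Tendsto (fun n => ∫ s, |(Kn n s (Iic y)).toReal - y| ∂((μn n).map Prod.fst)) atTop
        (nhds (∫ s, |(K s (Iic y)).toReal - y| ∂(μ.map Prod.fst))) := by
    intro y hy
    have hB : Tendsto (fun n => ∫ s, |(Kn n s (Iic y)).toReal - y| ∂(μ.map Prod.fst)) atTop
        (nhds (∫ s, |(K s (Iic y)).toReal - y| ∂(μ.map Prod.fst))) := by
      refine tendsto_integral_of_dominated_convergence (fun _ => 1)
        (fun n => (hmeas (Kn n) (hKn n) y).aestronglyMeasurable) (integrable_const _) ?_ ?_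
      · intro n
        refine ae_of_all _ fun s => ?_
        rw [Real.norm_eq_abs, abs_abs]
        exact kernel_bound (Kn n) s hy
      · filter_upwards [hΛae, hatom y] with s hs hs0
        exact ((weakConv_Iic _ _ (fun n => inferInstance) inferInstance (hΛ s hs) y
          hs0).sub_const y).abs
    have hA : Tendsto (fun n => ∫ s, |(Kn n s (Iic y)).toReal - y| ∂((μn n).map Prod.fst)
        - ∫ s, |(Kn n s (Iic y)).toReal - y| ∂(μ.map Prod.fst)) atTop (nhds 0) := by
      refine squeeze_zero_norm (fun n => ?_) htv
      exact tv_integral_bound _ _ _ (hmeas (Kn n) (hKn n) y) (fun _ => abs_nonneg _)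
        (fun s => kernel_bound (Kn n) s hy)
    simpa using hA.add hB
  unfold zeta1
  refine Tendsto.const_mul 3 ?_
  refine tendsto_integral_of_dominated_convergence (fun _ => 1) ?_ (integrable_const _) ?_ ?_
  · intro n
    exact ((measurable_kernel_Iic (Kn n)).stronglyMeasurable.integral_prod_right).aestronglyMeasurable
  · intro n
    refine (ae_restrict_iff' measurableSet_Icc).2 (ae_of_all _ fun y hy => ?_)
    refine (norm_integral_le_of_norm_le_const (C := 1) (ae_of_all _ fun s => ?_)).trans (by simp)
    rw [Real.norm_eq_abs, abs_abs]
    exact kernel_bound (Kn n) s hy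
  · exact (ae_restrict_iff' measurableSet_Icc).2 (ae_of_all _ hpt)
end
end
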